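/- Let (Ω, C, Λ) be a naive convex co-compact triple. If cdim_{F_Ω(x)}(∂_i C ∩ F_Ω(x)) = 0 for all x ∈ ∂_i C, then the metric space (C, d_Ω) is Gromov hyperbolic, where d_Ω is the Hilbert metric of Ω restricted to C. -/

import Mathlib

open Set Filter

noncomputable section

/-- Real projective space `P(ℝ^d)`, with the quotient topology. -/
abbrev PSpace (d : ℕ) := Projectivization ℝ (Fin d → ℝ)

instance PSpace.instTopologicalSpace (d : ℕ) : TopologicalSpace (PSpace d) :=
  inferInstanceAs (TopologicalSpace (Quotient (projectivizationSetoid ℝ (Fin d → ℝ))))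

namespace Paper

variable {d : ℕ}

/-- Inhomogeneous coordinates in the affine chart determined by the linear functional `f`:
a projective point `[v]` with `f v ≠ 0` is sent to the representative `v / f v` lying in the
affine hyperplane `{f = 1}`. -/
def chartMap (f : (Fin d → ℝ) →ₗ[ℝ] ℝ) (x : PSpace d) : Fin d → ℝ :=
  (f x.rep)⁻¹ • x.rep

/-- A subset of `P(ℝ^d)` is properly convex if there is an affine chart in which it is a
bounded convex set. -/
def IsProperlyConvex (C : Set (PSpace d)) : Prop :=
  ∃ f : (Fin d → ℝ) →ₗ[ℝ] ℝ, (∀ x ∈ closure C, f x.rep ≠ 0) ∧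
    Convex ℝ (chartMap f '' C) ∧ Bornology.IsBounded (chartMap f '' C)

/-- A properly convex domain: an open, nonempty, properly convex subset of `P(ℝ^d)`. -/
def IsPCDomain (Ω : Set (PSpace d)) : Prop :=
  IsOpen Ω ∧ Ω.Nonempty ∧ IsProperlyConvex Ω

open Classical in
/-- A choice of an affine chart containing the properly convex set `C`. -/
def chartOf (C : Set (PSpace d)) : (Fin d → ℝ) →ₗ[ℝ] ℝ :=
  if h : IsProperlyConvex C then h.choose else 0

/-- The chart map associated to the chosen chart of `C`. -/
def cmap (C : Set (PSpace d)) : PSpace d → Fin d → ℝ := chartMap (chartOf C)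

/-- The Hilbert distance between `u` and `v` computed in an affine chart where the convex set
is `O`: writing the line through `u, v` as `t ↦ u + t(v-u)`, with boundary parameters
`tm = inf {t | u + t(v-u) ∈ O} ≤ 0` and `tp = sup {...} ≥ 1`, the cross-ratio
`[a,u,v,b]` of `a = u + tm(v-u), u, v, b = u + tp(v-u)` equals `(tp(1-tm))/((-tm)(tp-1))`. -/
def hilbertDistChart (O : Set (Fin d → ℝ)) (u v : Fin d → ℝ) : ℝ :=
  if u = v then 0
  else
    (1 / 2) * Real.log
      ((sSup {t : ℝ | u + t • (v - u) ∈ O} * (1 - sInf {t : ℝ | u + t • (v - u) ∈ O})) /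
        ((-(sInf {t : ℝ | u + t • (v - u) ∈ O})) * (sSup {t : ℝ | u + t • (v - u) ∈ O} - 1)))

/-- The Hilbert metric of a properly convex set `C` (open in its span). -/
def hilbertDist (C : Set (PSpace d)) (x y : PSpace d) : ℝ :=
  hilbertDistChart (cmap C '' C) (cmap C x) (cmap C y)

/-- The closed projective line segment `[x,y]` contained in `closure C`. -/
def projSeg (C : Set (PSpace d)) (x y : PSpace d) : Set (PSpace d) :=
  {z ∈ closure C | cmap C z ∈ segment ℝ (cmap C x) (cmap C y)}

/-- The open projective line segment `(x,y)` contained in `closure C`. -/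
def projOpenSeg (C : Set (PSpace d)) (x y : PSpace d) : Set (PSpace d) :=
  {z ∈ closure C | cmap C z ∈ openSegment ℝ (cmap C x) (cmap C y)}

/-- The open face `F_C(x)` of a point `x ∈ closure C`: the set `{x}` together with all
`y ∈ closure C` such that some open line segment contained in `closure C` contains
both `x` and `y`. -/
def face (C : Set (PSpace d)) (x : PSpace d) : Set (PSpace d) :=
  insert x {y ∈ closure C | ∃ a ∈ closure C, ∃ b ∈ closure C,
    x ∈ projOpenSeg C a b ∧ y ∈ projOpenSeg C a b}

/-- The ideal boundary `∂_i C = closure C \ C`. -/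
def idealBdry (C : Set (PSpace d)) : Set (PSpace d) := closure C \ C

/-- The dimension of a subset `B`, computed in the chart of the ambient convex set `C`. -/
def pdimIn (C B : Set (PSpace d)) : ℕ :=
  Module.finrank ℝ (affineSpan ℝ (cmap C '' B)).direction

/-- The dimension of a convex subset of `P(ℝ^d)`. -/
def pdim (A : Set (PSpace d)) : ℕ := pdimIn A A

/-- The coarse dimension `cdim_C(A)` of a nonempty subset `A` of a properly convex set `C`
open in its span: the smallest `k` such that `A` is contained in an `R`-neighborhood (for the
Hilbert metric of `C`) of a `k`-dimensional convex subset `B ⊆ C`. -/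
def cdim (C A : Set (PSpace d)) : ℕ :=
  sInf {k : ℕ | ∃ R : ℝ, 0 < R ∧ ∃ B : Set (PSpace d), B ⊆ C ∧
    Convex ℝ (cmap C '' B) ∧ pdimIn C B = k ∧
    A ⊆ {p ∈ C | ∃ q ∈ B, hilbertDist C p q < R}}

/-- The cone over the standard open `(p-1)`-dimensional simplex: vectors whose first `p`
coordinates are positive and whose remaining coordinates vanish. -/
def simplexCone (p : ℕ) : Set (Fin d → ℝ) :=
  {v | (∀ i : Fin d, (i : ℕ) < p → 0 < v i) ∧ ∀ i : Fin d, p ≤ (i : ℕ) → v i = 0}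

/-- `S` is the image under `g ∈ PGL_d(ℝ)` of the standard open simplex with `p` vertices. -/
def IsSimplexWithMap (p : ℕ) (S : Set (PSpace d)) (g : (Fin d → ℝ) ≃ₗ[ℝ] (Fin d → ℝ)) : Prop :=
  S = {q : PSpace d | ∃ v ∈ simplexCone (d := d) p, ∃ hv : v ≠ 0,
        q = Projectivization.mk ℝ (g v) (by simpa using hv)}

/-- `S ⊆ P(ℝ^d)` is a simplex of dimension `k`. -/
def IsSimplexOfDim (k : ℕ) (S : Set (PSpace d)) : Prop :=
  k + 1 ≤ d ∧ ∃ g : (Fin d → ℝ) ≃ₗ[ℝ] (Fin d → ℝ), IsSimplexWithMap (k + 1) S g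

/-- `S` is a simplex with vertices `v 0, …, v (p-1)` (so of dimension `p - 1`). -/
def HasVertices {p : ℕ} (S : Set (PSpace d)) (v : Fin p → PSpace d) : Prop :=
  ∃ (hp : p ≤ d) (g : (Fin d → ℝ) ≃ₗ[ℝ] (Fin d → ℝ)),
    IsSimplexWithMap p S g ∧
    ∀ j : Fin p, v j = Projectivization.mk ℝ (g (Pi.single (Fin.castLE hp j) 1))
      (by
        simp only [ne_eq, EmbeddingLike.map_eq_zero_iff]
        intro h
        have h1 := congrFun h (Fin.castLE hp j)
        rw [Pi.single_eq_same] at h1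
        exact one_ne_zero (α := ℝ) h1)

/-- `A ⊆ B` is properly embedded if the inclusion map `A ↪ B` is proper. -/
def IsProperlyEmbedded (A B : Set (PSpace d)) : Prop :=
  ∃ h : A ⊆ B, IsProperMap (Set.inclusion h)

/-- The projective action of `GL(ℝ^d)` (hence of `PGL_d(ℝ)`) on `P(ℝ^d)`. -/
def pact (g : (Fin d → ℝ) ≃ₗ[ℝ] (Fin d → ℝ)) : PSpace d → PSpace d :=
  Projectivization.map g.toLinearMap g.injective

/-- A naive convex co-compact triple `(Ω, C, Λ)`. -/
structure NCCTriple (d : ℕ) where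
  Ω : Set (PSpace d)
  C : Set (PSpace d)
  Λ : Subgroup ((Fin d → ℝ) ≃ₗ[ℝ] (Fin d → ℝ))
  isOpen_Ω : IsOpen Ω
  nonempty_Ω : Ω.Nonempty
  properlyConvex_Ω : IsProperlyConvex Ω
  inv_Ω : ∀ g ∈ Λ, pact g '' Ω = Ω
  infinite_Λ : (Λ : Set ((Fin d → ℝ) ≃ₗ[ℝ] (Fin d → ℝ))).Infinite
  discrete_Λ : ∀ K ⊆ Ω, IsCompact K →
    {g : (Fin d → ℝ) ≃ₗ[ℝ] (Fin d → ℝ) | g ∈ Λ ∧ (pact g '' K ∩ K).Nonempty}.Finite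
  C_nonempty : C.Nonempty
  C_sub : C ⊆ Ω
  C_closedInΩ : closure C ∩ Ω ⊆ C
  C_convex : Convex ℝ (cmap Ω '' C)
  inv_C : ∀ g ∈ Λ, pact g '' C = C
  cocompact : ∃ K : Set (PSpace d), K ⊆ C ∧ IsCompact K ∧ C ⊆ ⋃ g ∈ Λ, pact g '' K

/-- The orbit of a point under a subgroup of `PGL_d(ℝ)`. -/
def porbit (Λ : Subgroup ((Fin d → ℝ) ≃ₗ[ℝ] (Fin d → ℝ))) (p : PSpace d) : Set (PSpace d) :=
  {q | ∃ g ∈ Λ, q = pact g p}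

/-- The full orbital limit set `L_Ω(Λ)`. -/
def limitSet (Ω : Set (PSpace d)) (Λ : Subgroup ((Fin d → ℝ) ≃ₗ[ℝ] (Fin d → ℝ))) :
    Set (PSpace d) :=
  ⋃ p ∈ Ω, (closure (porbit Λ p) \ porbit Λ p)

/-- The convex hull of `X ⊆ closure Ω` taken inside `Ω`. -/
def convHullIn (Ω X : Set (PSpace d)) : Set (PSpace d) :=
  {z ∈ Ω | cmap Ω z ∈ convexHull ℝ (cmap Ω '' X)}

/-- `C_Ω(Λ)`: the convex hull of the full orbital limit set in `Ω`. -/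
def coreC (Ω : Set (PSpace d)) (Λ : Subgroup ((Fin d → ℝ) ≃ₗ[ℝ] (Fin d → ℝ))) :
    Set (PSpace d) :=
  convHullIn Ω (limitSet Ω Λ)

/-- A convex co-compact group `Λ ⊆ Aut(Ω)`: an infinite discrete subgroup preserving `Ω`
such that `C_Ω(Λ)` is nonempty and `Λ` acts cocompactly on it. -/
structure CCSetup (d : ℕ) where
  Ω : Set (PSpace d)
  Λ : Subgroup ((Fin d → ℝ) ≃ₗ[ℝ] (Fin d → ℝ))
  isOpen_Ω : IsOpen Ω
  nonempty_Ω : Ω.Nonempty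
  properlyConvex_Ω : IsProperlyConvex Ω
  inv_Ω : ∀ g ∈ Λ, pact g '' Ω = Ω
  infinite_Λ : (Λ : Set ((Fin d → ℝ) ≃ₗ[ℝ] (Fin d → ℝ))).Infinite
  discrete_Λ : ∀ K ⊆ Ω, IsCompact K →
    {g : (Fin d → ℝ) ≃ₗ[ℝ] (Fin d → ℝ) | g ∈ Λ ∧ (pact g '' K ∩ K).Nonempty}.Finite
  core_nonempty : (coreC Ω Λ).Nonempty
  cocompact : ∃ K : Set (PSpace d), K ⊆ coreC Ω Λ ∧ IsCompact K ∧
    coreC Ω Λ ⊆ ⋃ g ∈ Λ, pact g '' K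

/-- The Gromov product of `x, y` at `w`, with respect to the Hilbert metric of `Ω`. -/
def gromovProd (Ω : Set (PSpace d)) (w x y : PSpace d) : ℝ :=
  (hilbertDist Ω x w + hilbertDist Ω y w - hilbertDist Ω x y) / 2

/-- `(C, d_Ω)` is Gromov hyperbolic. -/
def GromovHyperbolicOn (Ω C : Set (PSpace d)) : Prop :=
  ∃ δ : ℝ, 0 ≤ δ ∧ ∀ x ∈ C, ∀ y ∈ C, ∀ z ∈ C, ∀ w ∈ C,
    min (gromovProd Ω w x y) (gromovProd Ω w y z) - δ ≤ gromovProd Ω w x z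

/-- The open Hilbert-metric ball in `Ω`. -/
def hBall (Ω : Set (PSpace d)) (x : PSpace d) (r : ℝ) : Set (PSpace d) :=
  {y ∈ Ω | hilbertDist Ω x y < r}

/-- The Hausdorff distance between `A` and `B` (w.r.t. the Hilbert metric of `Ω`)
is less than `ε`. -/
def hausLT (Ω A B : Set (PSpace d)) (ε : ℝ) : Prop :=
  (∀ a ∈ A, ∃ b ∈ B, hilbertDist Ω a b < ε) ∧ ∀ b ∈ B, ∃ a ∈ A, hilbertDist Ω a b < ε

/-- The Hausdorff distance between `A` and `B` (w.r.t. the Hilbert metric of `Ω`)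
is at most `r`. -/
def hausdorffDistLE (Ω A B : Set (PSpace d)) (r : ℝ) : Prop :=
  ∀ ε : ℝ, 0 < ε → hausLT Ω A B (r + ε)

/-- Convergence `F n → C` in the local Hausdorff topology induced by `d_Ω`. -/
def LocalHausConv (Ω : Set (PSpace d)) (F : ℕ → Set (PSpace d)) (C : Set (PSpace d)) : Prop :=
  ∀ x ∈ Ω, ∀ r : ℝ, 0 < r → ∀ ε : ℝ, 0 < ε →
    ∀ᶠ n in atTop, hausLT Ω (F n ∩ hBall Ω x r) (C ∩ hBall Ω x r) ε

/-- A collection `𝒮` of closed subsets of `Ω` is closed and discrete in the local Hausdorff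
topology: any sequence in `𝒮` converging to a nonempty closed subset of `Ω` has limit in `𝒮`
and is eventually equal to its limit. -/
def ClosedAndDiscreteInLHT (Ω : Set (PSpace d)) (𝒮 : Set (Set (PSpace d))) : Prop :=
  ∀ F : ℕ → Set (PSpace d), (∀ n, F n ∈ 𝒮) →
    ∀ C : Set (PSpace d), C.Nonempty → C ⊆ Ω → closure C ∩ Ω ⊆ C → LocalHausConv Ω F C →
      C ∈ 𝒮 ∧ ∀ᶠ n in atTop, F n = C


section ConeLemmas

variable {E : Type*} [AddCommGroup E] [Module ℝ E]

structure ConeS (K : Set E) (f : E →ₗ[ℝ] ℝ) : Prop where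
  smul : ∀ c : ℝ, 0 < c → ∀ v ∈ K, c • v ∈ K
  add : ∀ u ∈ K, ∀ v ∈ K, u + v ∈ K
  op : ∀ u ∈ K, ∀ v ∈ K, ∃ ε : ℝ, 0 < ε ∧ u - ε • v ∈ K
  pos : ∀ v ∈ K, 0 < f v

def MM (K : Set E) (u v : E) : ℝ := sInf {l : ℝ | l • v - u ∈ K}

def DD (K : Set E) (u v : E) : ℝ := (Real.log (MM K u v) + Real.log (MM K v u)) / 2

variable {K : Set E} {f : E →ₗ[ℝ] ℝ}

theorem ConeS.lb (hK : ConeS K f) {u v : E} (hv : v ∈ K) {l : ℝ}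
    (h : l • v - u ∈ K) : f u / f v < l := by
  have h1 := hK.pos _ h
  have h2 := hK.pos _ hv
  simp only [map_sub, map_smul, smul_eq_mul] at h1
  rw [div_lt_iff₀ h2]; linarith

theorem ConeS.bdd (hK : ConeS K f) {u v : E} (hv : v ∈ K) :
    BddBelow {l : ℝ | l • v - u ∈ K} :=
  ⟨f u / f v, fun _ h => (hK.lb hv h).le⟩

theorem ConeS.ne (hK : ConeS K f) {u v : E} (hu : u ∈ K) (hv : v ∈ K) :
    {l : ℝ | l • v - u ∈ K}.Nonempty := by
  obtain ⟨ε, h0, h⟩ := hK.op v hv u hu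
  refine ⟨ε⁻¹, ?_⟩
  have := hK.smul ε⁻¹ (by positivity) _ h
  rwa [smul_sub, smul_smul, inv_mul_cancel₀ h0.ne', one_smul] at this

theorem ConeS.mem_iff (hK : ConeS K f) {u v : E} (hu : u ∈ K) (hv : v ∈ K) {l : ℝ} :
    l • v - u ∈ K ↔ MM K u v < l := by
  constructor
  · intro h
    obtain ⟨ε, h0, h1⟩ := hK.op _ h v hv
    have : MM K u v ≤ l - ε := by
      apply csInf_le (hK.bdd hv)
      show (l - ε) • v - u ∈ K
      convert h1 using 1; module
    linarith
  · intro h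
    obtain ⟨m, hm, hml⟩ := exists_lt_of_csInf_lt (hK.ne hu hv) h
    have := hK.add _ hm _ (hK.smul (l - m) (by linarith) v hv)
    convert this using 1; module

theorem ConeS.MM_ge (hK : ConeS K f) {u v : E} (hu : u ∈ K) (hv : v ∈ K) :
    f u / f v ≤ MM K u v :=
  le_csInf (hK.ne hu hv) fun _ h => (hK.lb hv h).le

theorem ConeS.MM_pos (hK : ConeS K f) {u v : E} (hu : u ∈ K) (hv : v ∈ K) :
    0 < MM K u v :=
  lt_of_lt_of_le (div_pos (hK.pos _ hu) (hK.pos _ hv)) (hK.MM_ge hu hv)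

theorem ConeS.MM_le (hK : ConeS K f) {u v : E} (hu : u ∈ K) (hv : v ∈ K) {l : ℝ}
    (h : l • v - u ∈ K ∨ l • v - u = 0) : MM K u v ≤ l := by
  rcases h with h | h
  · exact ((hK.mem_iff hu hv).1 h).le
  · refine le_of_forall_gt fun m hm => (hK.mem_iff hu hv).1 ?_
    have := hK.smul (m - l) (by linarith) v hv
    convert this using 1
    have : u = l • v := (sub_eq_zero.1 h).symm
    rw [this]; module

theorem ConeS.MM_self (hK : ConeS K f) {u : E} (hu : u ∈ K) : MM K u u = 1 := by
  apply le_antisymm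
  · exact hK.MM_le hu hu (Or.inr (by simp))
  · have := hK.MM_ge hu hu
    rwa [div_self (hK.pos _ hu).ne'] at this

theorem ConeS.MM_tri (hK : ConeS K f) {u v w : E} (hu : u ∈ K) (hv : v ∈ K) (hw : w ∈ K) :
    MM K u w ≤ MM K u v * MM K v w := by
  have key : ∀ a, MM K u v < a → ∀ b, MM K v w < b → MM K u w ≤ a * b := by
    intro a ha b hb
    have h1 := (hK.mem_iff hu hv).2 ha
    have h2 := (hK.mem_iff hv hw).2 hb
    have ha0 : 0 < a := (hK.MM_pos hu hv).trans ha
    have := hK.add _ h1 _ (hK.smul a ha0 _ h2)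
    refine hK.MM_le hu hw (Or.inl ?_)
    convert this using 1; module
  have h1 : ∀ a, MM K u v < a → MM K u w ≤ a * MM K v w := by
    intro a ha
    have ha0 : 0 < a := (hK.MM_pos hu hv).trans ha
    rw [← div_le_iff₀' ha0]
    refine le_of_forall_gt_imp_ge_of_dense fun b hb => ?_
    rw [div_le_iff₀' ha0]; exact key a ha b hb
  have hp := hK.MM_pos hv hw
  rw [← div_le_iff₀ hp]
  refine le_of_forall_gt_imp_ge_of_dense fun a ha => ?_
  rw [div_le_iff₀ hp]; exact h1 a ha

theorem ConeS.MM_smul (hK : ConeS K f) {u v : E} (hu : u ∈ K) (hv : v ∈ K) {a b : ℝ}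
    (ha : 0 < a) (hb : 0 < b) : MM K (a • u) (b • v) = a / b * MM K u v := by
  have hu' := hK.smul a ha u hu
  have hv' := hK.smul b hb v hv
  refine eq_of_forall_gt_iff fun c => ?_
  rw [← hK.mem_iff hu' hv']
  have : c • b • v - a • u = a • ((c * b / a) • v - u) := by
    rw [smul_sub, smul_smul, smul_smul]; congr 2; field_simp
  rw [this]
  have h2 : a • ((c * b / a) • v - u) ∈ K ↔ (c * b / a) • v - u ∈ K := by
    constructor
    · intro h
      have := hK.smul a⁻¹ (by positivity) _ h
      rwa [smul_smul, inv_mul_cancel₀ ha.ne', one_smul] at this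
    · exact hK.smul a ha _
  rw [h2, hK.mem_iff hu hv, lt_div_iff₀ ha, div_mul_eq_mul_div, div_lt_iff₀ hb, mul_comm a]

theorem ConeS.DD_smul (hK : ConeS K f) {u v : E} (hu : u ∈ K) (hv : v ∈ K) {a b : ℝ}
    (ha : 0 < a) (hb : 0 < b) : DD K (a • u) (b • v) = DD K u v := by
  have h1 := hK.MM_pos hu hv
  have h2 := hK.MM_pos hv hu
  rw [DD, DD, hK.MM_smul hu hv ha hb, hK.MM_smul hv hu hb ha,
    Real.log_mul (by positivity) h1.ne', Real.log_mul (by positivity) h2.ne',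
    Real.log_div ha.ne' hb.ne', Real.log_div hb.ne' ha.ne']
  ring

theorem DD_comm (u v : E) : DD K u v = DD K v u := by
  rw [DD, DD, add_comm]

theorem ConeS.DD_self (hK : ConeS K f) {u : E} (hu : u ∈ K) : DD K u u = 0 := by
  simp [DD, hK.MM_self hu]

theorem ConeS.DD_tri (hK : ConeS K f) {u v w : E} (hu : u ∈ K) (hv : v ∈ K) (hw : w ∈ K) :
    DD K u w ≤ DD K u v + DD K v w := by
  have h1 := Real.log_le_log (hK.MM_pos hu hw) (hK.MM_tri hu hv hw)
  have h2 := Real.log_le_log (hK.MM_pos hw hu) (hK.MM_tri hw hv hu)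
  rw [Real.log_mul (hK.MM_pos hu hv).ne' (hK.MM_pos hv hw).ne'] at h1
  rw [Real.log_mul (hK.MM_pos hw hv).ne' (hK.MM_pos hv hu).ne'] at h2
  simp only [DD]; linarith

theorem ConeS.comb_mem (hK : ConeS K f) {u v : E} (hu : u ∈ K) (hv : v ∈ K) {a b : ℝ}
    (ha : 0 ≤ a) (hb : 0 ≤ b) (hab : 0 < a + b) : a • u + b • v ∈ K := by
  rcases ha.eq_or_lt with rfl | ha
  · simpa using hK.smul b (by linarith) v hv
  rcases hb.eq_or_lt with rfl | hb
  · simpa using hK.smul a (by linarith) u hu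
  exact hK.add _ (hK.smul a ha u hu) _ (hK.smul b hb v hv)

theorem ConeS.MM_geod (hK : ConeS K f) {u v : E} (hu : u ∈ K) (hv : v ∈ K) {a b : ℝ}
    (ha : 0 ≤ a) (hb : 0 ≤ b) (hab : 0 < a + b) :
    MM K u (a • u + b • v) * MM K (a • u + b • v) v ≤ MM K u v := by
  have hp := hK.comb_mem hu hv ha hb hab
  refine le_of_forall_gt_imp_ge_of_dense fun l hl => ?_
  have hl0 : 0 < l := (hK.MM_pos hu hv).trans hl
  have hm := (hK.mem_iff hu hv).2 hl
  have hlab : 0 < l * a + b := by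
    rcases ha.eq_or_lt with rfl | ha
    · linarith
    · positivity
  have h1 : MM K u (a • u + b • v) ≤ l / (l * a + b) := by
    refine hK.MM_le hu hp ?_
    have e : (l / (l * a + b)) • (a • u + b • v) - u = (b / (l * a + b)) • (l • v - u) := by
      have h3 : l / (l * a + b) * a = 1 - b / (l * a + b) := by field_simp; ring
      have h4 : l / (l * a + b) * b = b / (l * a + b) * l := by field_simp
      rw [smul_add, smul_smul, smul_smul, smul_sub, smul_smul, h3, h4]; module
    rw [e]
    rcases hb.eq_or_lt with rfl | hb
    · right; simp
    · left; exact hK.smul _ (by positivity) _ hm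
  have h2 : MM K (a • u + b • v) v ≤ l * a + b := by
    refine hK.MM_le hp hv ?_
    have e : (l * a + b) • v - (a • u + b • v) = a • (l • v - u) := by module
    rw [e]
    rcases ha.eq_or_lt with rfl | ha
    · right; simp
    · left; exact hK.smul _ ha _ hm
  calc _ ≤ l / (l * a + b) * (l * a + b) :=
        mul_le_mul h1 h2 (hK.MM_pos hp hv).le (by positivity)
    _ = l := by field_simp

theorem ConeS.DD_geod (hK : ConeS K f) {u v : E} (hu : u ∈ K) (hv : v ∈ K) {a b : ℝ}
    (ha : 0 ≤ a) (hb : 0 ≤ b) (hab : 0 < a + b) :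
    DD K u (a • u + b • v) + DD K (a • u + b • v) v ≤ DD K u v := by
  have hp := hK.comb_mem hu hv ha hb hab
  have h1 := hK.MM_geod hu hv ha hb hab
  have h2 := hK.MM_geod hv hu hb ha (by linarith)
  rw [add_comm (b • v)] at h2
  have h1 := Real.log_le_log (mul_pos (hK.MM_pos hu hp) (hK.MM_pos hp hv)) h1
  have h2 := Real.log_le_log (mul_pos (hK.MM_pos hv hp) (hK.MM_pos hp hu)) h2
  rw [Real.log_mul (hK.MM_pos hu hp).ne' (hK.MM_pos hp hv).ne'] at h1
  rw [Real.log_mul (hK.MM_pos hv hp).ne' (hK.MM_pos hp hu).ne'] at h2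
  simp only [DD]; linarith

theorem ConeS.DD_le (hK : ConeS K f) {u v : E} (hu : u ∈ K) (hv : v ∈ K) {l : ℝ}
    (h1 : l • v - u ∈ K) (h2 : l • u - v ∈ K) : DD K u v ≤ Real.log l := by
  have h1 := Real.log_le_log (hK.MM_pos hu hv) (hK.MM_le hu hv (Or.inl h1))
  have h2 := Real.log_le_log (hK.MM_pos hv hu) (hK.MM_le hv hu (Or.inl h2))
  simp only [DD]; linarith

theorem DD_map (g : E →ₗ[ℝ] E) (hg : ∀ v, g v ∈ K ↔ v ∈ K) (u v : E) :
    DD K (g u) (g v) = DD K u v := by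
  have : ∀ u v, MM K (g u) (g v) = MM K u v := by
    intro u v
    simp only [MM, ← map_smul, ← map_sub, hg]
  simp only [DD, this]

theorem ConeS.cross (hK : ConeS K f) {u v : E} (hu : u ∈ K) (hv : v ∈ K)
    (h1 : 1 < MM K u v) (h2 : 1 < MM K v u) :
    {t : ℝ | u + t • (v - u) ∈ K} =
      Ioo (-(1 / (MM K v u - 1))) (MM K u v / (MM K u v - 1)) := by
  have p1 : 0 < MM K u v - 1 := by linarith
  have p2 : 0 < MM K v u - 1 := by linarith
  ext t
  simp only [mem_ofPred_eq, mem_Ioo]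
  rcases lt_or_ge t 0 with ht | ht
  · have ht' : 0 < -t := by linarith
    have e : u + t • (v - u) = (-t) • (((1 - t) / (-t)) • u - v) := by
      rw [smul_sub (-t), smul_smul, mul_div_cancel₀ _ ht'.ne']; module
    have e' : u + t • (v - u) ∈ K ↔ ((1 - t) / (-t)) • u - v ∈ K := by
      rw [e]
      constructor
      · intro h
        have := hK.smul (-t)⁻¹ (by positivity) _ h
        rwa [smul_smul, inv_mul_cancel₀ ht'.ne', one_smul] at this
      · exact hK.smul _ ht' _
    rw [e', hK.mem_iff hv hu, lt_div_iff₀ ht']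
    have h3 : 0 < MM K u v / (MM K u v - 1) := by positivity
    have h4 : -(1 / (MM K v u - 1)) < t ↔ -t * (MM K v u - 1) < 1 := by
      rw [neg_lt, lt_div_iff₀ p2]
    rw [h4]
    constructor
    · intro h; exact ⟨by linarith, by linarith⟩
    · intro h; linarith [h.1]
  rcases lt_or_ge 1 t with ht1 | ht1
  · have ht' : 0 < t - 1 := by linarith
    have e : u + t • (v - u) = (t - 1) • ((t / (t - 1)) • v - u) := by
      rw [smul_sub (t - 1), smul_smul, mul_div_cancel₀ _ ht'.ne']; module
    have e' : u + t • (v - u) ∈ K ↔ (t / (t - 1)) • v - u ∈ K := by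
      rw [e]
      constructor
      · intro h
        have := hK.smul (t - 1)⁻¹ (by positivity) _ h
        rwa [smul_smul, inv_mul_cancel₀ ht'.ne', one_smul] at this
      · exact hK.smul _ ht' _
    rw [e', hK.mem_iff hu hv, lt_div_iff₀ ht', lt_div_iff₀ p1]
    have h3 : 0 < 1 / (MM K v u - 1) := by positivity
    constructor
    · intro h; exact ⟨by linarith, by linarith⟩
    · intro h; linarith [h.2]
  · have h3 : 0 < 1 / (MM K v u - 1) := by positivity
    have h4 : 1 < MM K u v / (MM K u v - 1) := by rw [lt_div_iff₀ p1]; linarith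
    have : u + t • (v - u) ∈ K := by
      have := hK.comb_mem hu hv (a := 1 - t) (b := t) (by linarith) ht (by linarith)
      convert this using 1; module
    exact ⟨fun _ => ⟨by linarith, by linarith⟩, fun _ => this⟩

theorem ConeS.cross_dist (hK : ConeS K f) {u v : E} (hu : u ∈ K) (hv : v ∈ K)
    (h1 : 1 < MM K u v) (h2 : 1 < MM K v u) :
    (1 / 2) * Real.log
      ((sSup {t : ℝ | u + t • (v - u) ∈ K} * (1 - sInf {t : ℝ | u + t • (v - u) ∈ K})) /
        ((-(sInf {t : ℝ | u + t • (v - u) ∈ K})) * (sSup {t : ℝ | u + t • (v - u) ∈ K} - 1)))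
    = DD K u v := by
  have p1 : 0 < MM K u v - 1 := by linarith
  have p2 : 0 < MM K v u - 1 := by linarith
  have h3 : 0 < 1 / (MM K v u - 1) := by positivity
  have h4 : 0 < MM K u v / (MM K u v - 1) := by positivity
  have hlt : -(1 / (MM K v u - 1)) < (MM K u v / (MM K u v - 1)) := by linarith
  rw [hK.cross hu hv h1 h2, csSup_Ioo hlt, csInf_Ioo hlt, DD,
    ← Real.log_mul (by positivity) (by positivity)]
  have e : MM K u v / (MM K u v - 1) * (1 - -(1 / (MM K v u - 1))) /
      (- -(1 / (MM K v u - 1)) * (MM K u v / (MM K u v - 1) - 1)) = MM K u v * MM K v u := by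
    have q : MM K u v / (MM K u v - 1) - 1 = 1 / (MM K u v - 1) := by field_simp; ring
    rw [q]; field_simp; ring
  rw [e]; ring

end ConeLemmas

section ConeTop

variable {E : Type*} [NormedAddCommGroup E] [NormedSpace ℝ E]
variable {K : Set E} {f : E →ₗ[ℝ] ℝ}

theorem ConeS.one_lt (hK : ConeS K f) (hb : Bornology.IsBounded {v ∈ K | f v = 1})
    {u v : E} (hu : u ∈ K) (hv : v ∈ K) (fu : f u = 1) (fv : f v = 1) (huv : u ≠ v) :
    1 < MM K u v := by
  by_contra hcon
  push Not at hcon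
  obtain ⟨B, hB⟩ := hb.exists_norm_le
  have hn : 0 < ‖v - u‖ := norm_pos_iff.2 (sub_ne_zero.2 huv.symm)
  have key : ∀ N : ℝ, 0 < N → N * ‖v - u‖ ≤ B + ‖v‖ := by
    intro N hN
    have h1 : (1 + N⁻¹) • v - u ∈ K := by
      rw [hK.mem_iff hu hv]
      have : 0 < N⁻¹ := by positivity
      linarith
    have h2 := hK.smul N hN _ h1
    have e : N • ((1 + N⁻¹) • v - u) = N • (v - u) + v := by
      have : N * (1 + N⁻¹) = N + 1 := by field_simp
      rw [smul_sub, smul_smul, this]; module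
    rw [e] at h2
    have h3 := hB _ ⟨h2, by simp [fu, fv]⟩
    have h4 : ‖N • (v - u)‖ ≤ ‖N • (v - u) + v‖ + ‖v‖ := by
      have := norm_sub_le (N • (v - u) + v) v
      simpa using this
    rw [norm_smul, Real.norm_of_nonneg hN.le] at h4
    linarith
  have hB0 : 0 ≤ B := (norm_nonneg v).trans (hB v ⟨hv, fv⟩)
  have h5 := key ((B + ‖v‖ + 1) / ‖v - u‖) (by positivity)
  rw [div_mul_cancel₀ _ hn.ne'] at h5
  linarith

theorem ConeS.ofOpen (hs : ∀ c : ℝ, 0 < c → ∀ v ∈ K, c • v ∈ K)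
    (ha : ∀ u ∈ K, ∀ v ∈ K, u + v ∈ K) (hp : ∀ v ∈ K, 0 < f v) (ho : IsOpen K) : ConeS K f := by
  refine ⟨hs, ha, fun u hu v hv => ?_, hp⟩
  have hc : Continuous fun ε : ℝ => u - ε • v := by fun_prop
  have h1 : ∀ᶠ ε in nhds (0 : ℝ), u - ε • v ∈ K :=
    hc.continuousAt.eventually (by simpa using ho.mem_nhds hu)
  have h2 : ∀ᶠ ε in nhdsWithin (0 : ℝ) (Ioi 0), u - ε • v ∈ K := h1.filter_mono nhdsWithin_le_nhds
  obtain ⟨ε, h, h'⟩ := (h2.and self_mem_nhdsWithin).exists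
  exact ⟨ε, h', h⟩

theorem ConeS.closure_add (hK : ConeS K f) {u v : E} (hu : u ∈ closure K) (hv : v ∈ closure K) :
    u + v ∈ closure K :=
  map_mem_closure₂ continuous_add hu hv hK.add

theorem ConeS.closure_smul (hK : ConeS K f) {u : E} (hu : u ∈ closure K) {c : ℝ} (hc : 0 < c) :
    c • u ∈ closure K :=
  map_mem_closure (continuous_const_smul c) hu (hK.smul c hc)

theorem ConeS.closure_add_mem (hK : ConeS K f) (ho : IsOpen K) {u v : E}
    (hu : u ∈ closure K) (hv : v ∈ K) : u + v ∈ K := by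
  have hc : Continuous fun x : E => u + v - x := by fun_prop
  have h1 : {x : E | u + v - x ∈ K} ∈ nhds u :=
    hc.continuousAt.preimage_mem_nhds (by simpa using ho.mem_nhds hv)
  obtain ⟨x, hx, hxK⟩ := mem_closure_iff_nhds.1 hu _ h1
  have := hK.add _ hx _ hxK
  simpa using this

theorem ConeS.fourpoint (hK : ConeS K f) (ho : IsOpen K) {C : Set E}
    (hCK : C ⊆ K) {δ : ℝ}
    (thin : ∀ x ∈ C, ∀ y ∈ C, ∀ z ∈ C, ∀ s t : ℝ, 0 ≤ s → 0 ≤ t → 0 < s + t →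
      ∃ a b : ℝ, 0 ≤ a ∧ 0 ≤ b ∧ 0 < a + b ∧
        (DD K (s • x + t • y) (a • x + b • z) ≤ δ ∨ DD K (s • x + t • y) (a • z + b • y) ≤ δ)) :
    ∃ δ' : ℝ, 0 ≤ δ' ∧ ∀ x ∈ C, ∀ y ∈ C, ∀ z ∈ C, ∀ w ∈ C,
      min ((DD K x w + DD K y w - DD K x y) / 2) ((DD K y w + DD K z w - DD K y z) / 2) - δ' ≤
        (DD K x w + DD K z w - DD K x z) / 2 := by
  have upper : ∀ x ∈ C, ∀ y ∈ C, ∀ w ∈ C, ∀ a b : ℝ, 0 ≤ a → 0 ≤ b → 0 < a + b →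
      (DD K x w + DD K y w - DD K x y) / 2 ≤ DD K (a • x + b • y) w := by
    intro x hx y hy w hw a b ha hb hab
    have hp := hK.comb_mem (hCK hx) (hCK hy) ha hb hab
    have h1 := hK.DD_geod (hCK hx) (hCK hy) ha hb hab
    have h2 := hK.DD_tri (hCK hx) hp (hCK hw)
    have h3 := hK.DD_tri (hCK hy) hp (hCK hw)
    rw [DD_comm y (a • x + b • y)] at h3
    linarith
  have lower : ∀ x ∈ C, ∀ y ∈ C, ∀ w ∈ C, ∃ a b : ℝ, 0 ≤ a ∧ 0 ≤ b ∧ 0 < a + b ∧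
      DD K (a • x + b • y) w - 2 * (δ + 1) ≤ (DD K x w + DD K y w - DD K x y) / 2 := by
    intro x hx y hy w hw
    set p : ℝ → E := fun t => (1 - t) • x + t • y with hp
    have hpK : ∀ t ∈ Icc (0 : ℝ) 1, p t ∈ K := fun t ht =>
      hK.comb_mem (hCK hx) (hCK hy) (by linarith [ht.2]) ht.1 (by linarith)
    have hpc : Continuous p := by fun_prop
    have loc : ∀ t ∈ Icc (0 : ℝ) 1, ∃ ε > 0, ∀ r ∈ Icc (0 : ℝ) 1, |r - t| < ε →
        DD K (p t) (p r) ≤ 1 := by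
      intro t ht
      have he : (0 : ℝ) < Real.exp 1 - 1 := by
        have := Real.add_one_lt_exp (one_ne_zero (α := ℝ)); linarith
      have hm : Real.exp 1 • p t - p t ∈ K := by
        have := hK.smul _ he _ (hpK t ht)
        convert this using 1; module
      have c1 : Continuous fun r => Real.exp 1 • p r - p t := by fun_prop
      have c2 : Continuous fun r => Real.exp 1 • p t - p r := by fun_prop
      have e1 := c1.continuousAt.eventually (ho.mem_nhds hm)
      have e2 := c2.continuousAt.eventually (ho.mem_nhds hm)
      obtain ⟨ε, hε, h⟩ := Metric.eventually_nhds_iff.1 (e1.and e2)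
      refine ⟨ε, hε, fun r hr hrt => ?_⟩
      have := h (y := r) hrt
      have := hK.DD_le (hpK t ht) (hpK r hr) this.1 this.2
      rwa [Real.log_exp] at this
    -- the set of parameters close to `[x,w]`
    set A : Set ℝ := {t | t ∈ Icc (0 : ℝ) 1 ∧ ∃ a b : ℝ, 0 ≤ a ∧ 0 ≤ b ∧ 0 < a + b ∧
      DD K (p t) (a • x + b • w) ≤ max δ 0} with hA
    have hδ0 : 0 ≤ max δ 0 := le_max_right _ _
    have h0A : (0 : ℝ) ∈ A := by
      refine ⟨by simp, 1, 0, by simp, by simp, by simp, ?_⟩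
      simp [hp, hK.DD_self (hCK hx)]
    have hAb : BddAbove A := ⟨1, fun t ht => ht.1.2⟩
    set t₀ := sSup A with ht₀
    have ht0 : t₀ ∈ Icc (0 : ℝ) 1 := ⟨le_csSup hAb h0A, csSup_le ⟨0, h0A⟩ fun t ht => ht.1.2⟩
    have hδ : 0 ≤ δ := by
      obtain ⟨a, b, ha, hb, hab, h⟩ := thin x hx x hx x hx 1 0 (by simp) (by simp) (by simp)
      have e : ∀ a b : ℝ, a • x + b • x = (a + b) • x := fun a b => by module
      rw [e, e] at h
      rw [hK.DD_smul (hCK hx) (hCK hx) (by simp) hab, hK.DD_self (hCK hx)] at h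
      simpa using h
    rw [max_eq_left hδ] at hA
    obtain ⟨ε, hε, hloc⟩ := loc t₀ ht0
    have near1 : ∃ a b : ℝ, 0 ≤ a ∧ 0 ≤ b ∧ 0 < a + b ∧
        DD K (p t₀) (a • x + b • w) ≤ δ + 1 := by
      obtain ⟨r, hr, hr'⟩ := exists_lt_of_lt_csSup ⟨0, h0A⟩ (show t₀ - ε < sSup A by linarith)
      have hr1 : r ≤ t₀ := le_csSup hAb hr
      have hd := hloc r hr.1 (by rw [abs_lt]; constructor <;> linarith)
      obtain ⟨hrI, a, b, ha, hb, hab, h⟩ := hr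
      refine ⟨a, b, ha, hb, hab, ?_⟩
      rw [max_eq_left hδ] at h
      have := hK.DD_tri (hpK _ ht0) (hpK r hrI) (hK.comb_mem (hCK hx) (hCK hw) ha hb hab)
      linarith
    have near2 : ∃ a b : ℝ, 0 ≤ a ∧ 0 ≤ b ∧ 0 < a + b ∧
        DD K (p t₀) (a • w + b • y) ≤ δ + 1 := by
      rcases ht0.2.eq_or_lt with h1 | h1
      · refine ⟨0, 1, by simp, by simp, by simp, ?_⟩
        rw [h1]
        simp only [hp, sub_self, zero_smul, one_smul, zero_add]
        rw [hK.DD_self (hCK hy)]; linarith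
      · set r := min 1 (t₀ + ε / 2) with hr
        have hr1 : t₀ < r := lt_min h1 (by linarith)
        have hr2 : r ≤ t₀ + ε / 2 := min_le_right _ _
        have hrI : r ∈ Icc (0 : ℝ) 1 := ⟨by linarith [ht0.1], min_le_left _ _⟩
        have hd := hloc r hrI (by rw [abs_lt]; constructor <;> linarith)
        obtain ⟨a, b, ha, hb, hab, h⟩ := thin x hx y hy w hw (1 - r) r (by linarith [hrI.2])
          hrI.1 (by linarith)
        rcases h with h | h
        · exfalso
          have : r ∈ A := ⟨hrI, a, b, ha, hb, hab, h.trans (le_max_left _ _)⟩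
          linarith [le_csSup hAb this]
        · refine ⟨a, b, ha, hb, hab, ?_⟩
          have := hK.DD_tri (hpK _ ht0) (hpK r hrI) (hK.comb_mem (hCK hw) (hCK hy) ha hb hab)
          have h' : DD K (p r) (a • w + b • y) ≤ δ := h
          linarith
    obtain ⟨a, b, ha, hb, hab, h1⟩ := near1
    obtain ⟨a', b', ha', hb', hab', h2⟩ := near2
    have hq := hK.comb_mem (hCK hx) (hCK hw) ha hb hab
    have hr := hK.comb_mem (hCK hw) (hCK hy) ha' hb' hab'
    have hP := hpK _ ht0
    refine ⟨1 - t₀, t₀, by linarith [ht0.2], ht0.1, by linarith, ?_⟩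
    change DD K (p t₀) w - _ ≤ _
    set q := a • x + b • w
    set r := a' • w + b' • y
    have g1 : DD K x q + DD K q w ≤ DD K x w := hK.DD_geod (hCK hx) (hCK hw) ha hb hab
    have g2 : DD K w r + DD K r y ≤ DD K w y := hK.DD_geod (hCK hw) (hCK hy) ha' hb' hab'
    have i1 := hK.DD_tri (hCK hx) hq hP
    have i2 := hK.DD_tri hP hq (hCK hw)
    have i3 := hK.DD_tri hP hr (hCK hy)
    have i4 := hK.DD_tri hP hr (hCK hw)
    have i5 := hK.DD_tri (hCK hx) hP (hCK hy)
    rw [DD_comm q] at i1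
    rw [DD_comm r w] at i4
    rw [DD_comm w y] at g2
    linarith
  refine ⟨2 * (|δ| + 1) + |δ|, by positivity, fun x hx y hy z hz w hw => ?_⟩
  have hδ := le_abs_self δ
  obtain ⟨s, t, hs, ht, hst, hl⟩ := lower x hx z hz w hw
  obtain ⟨a, b, ha, hb, hab, h⟩ := thin x hx z hz y hy s t hs ht hst
  have hP := hK.comb_mem (hCK hx) (hCK hz) hs ht hst
  rcases h with h | h
  · have hq := hK.comb_mem (hCK hx) (hCK hy) ha hb hab
    have := upper x hx y hy w hw a b ha hb hab
    have h2 := hK.DD_tri hq hP (hCK hw)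
    rw [DD_comm (a • x + b • y) (s • x + t • z)] at h2
    have := min_le_left ((DD K x w + DD K y w - DD K x y) / 2) ((DD K y w + DD K z w - DD K y z) / 2)
    linarith
  · have hq := hK.comb_mem (hCK hy) (hCK hz) ha hb hab
    have := upper y hy z hz w hw a b ha hb hab
    have h2 := hK.DD_tri hq hP (hCK hw)
    rw [DD_comm (a • y + b • z) (s • x + t • z)] at h2
    have := min_le_right ((DD K x w + DD K y w - DD K x y) / 2) ((DD K y w + DD K z w - DD K y z) / 2)
    linarith

theorem ConeS.thin [FiniteDimensional ℝ E] (hK : ConeS K f) (ho : IsOpen K)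
    (hb : Bornology.IsBounded {v ∈ K | f v = 1}) {C Q : Set E}
    (hCK : C ⊆ K) (hCs : ∀ c : ℝ, 0 < c → ∀ v ∈ C, c • v ∈ C)
    (hQ : IsCompact Q) (hQK : Q ⊆ K)
    (hG : ∀ u ∈ C, ∃ g : E →ₗ[ℝ] E, (∀ v, g v ∈ K ↔ v ∈ K) ∧ (∀ v ∈ C, g v ∈ C) ∧ g u ∈ Q)
    (hCa : ∀ u ∈ C, ∀ v ∈ C, u + v ∈ C)
    (H : ∀ x ∈ closure C, ∀ z ∈ closure C, f x = 1 → f z = 1 →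
      (∀ a b : ℝ, 0 ≤ a → 0 ≤ b → 0 < a + b → a • x + b • z ∉ K) →
      ∃ L : ℝ, L • x - z ∈ closure K) :
    ∃ δ : ℝ, ∀ x ∈ C, ∀ y ∈ C, ∀ z ∈ C, ∀ s t : ℝ, 0 ≤ s → 0 ≤ t → 0 < s + t →
      ∃ a b : ℝ, 0 ≤ a ∧ 0 ≤ b ∧ 0 < a + b ∧
        (DD K (s • x + t • y) (a • x + b • z) ≤ δ ∨
          DD K (s • x + t • y) (a • z + b • y) ≤ δ) := by
  have hfc : Continuous f := f.continuous_of_finiteDimensional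
  by_contra hcon
  push Not at hcon
  -- normalised counterexamples
  obtain ⟨S, hS⟩ : ∃ S, ∀ u ∈ Q, f u ≤ S := by
    obtain ⟨S, hS⟩ := (hQ.image hfc).bddAbove
    exact ⟨S, fun u hu => hS ⟨u, hu, rfl⟩⟩
  have norm1 : ∀ n : ℕ, ∃ x ∈ C, ∃ y ∈ C, ∃ z ∈ C, f x = 1 ∧ f y = 1 ∧ f z = 1 ∧ ∃ s t : ℝ,
      0 ≤ s ∧ 0 ≤ t ∧ s + t ≤ S ∧ s • x + t • y ∈ Q ∧ ∀ a b : ℝ, 0 ≤ a → 0 ≤ b → 0 < a + b →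
        (n : ℝ) < DD K (s • x + t • y) (a • x + b • z) ∧
        (n : ℝ) < DD K (s • x + t • y) (a • z + b • y) := by
    intro n
    obtain ⟨x, hx, y, hy, z, hz, s, t, hs, ht, hst, h⟩ := hcon n
    have hu : s • x + t • y ∈ C := by
      rcases hs.eq_or_lt with rfl | hs
      · simpa using hCs t (by linarith) y hy
      rcases ht.eq_or_lt with rfl | ht
      · simpa using hCs s (by linarith) x hx
      exact hCa _ (hCs s hs x hx) _ (hCs t ht y hy)
    obtain ⟨g, gK, gC, gu⟩ := hG _ hu
    have px := hK.pos _ (hCK (gC x hx))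
    have py := hK.pos _ (hCK (gC y hy))
    have pz := hK.pos _ (hCK (gC z hz))
    have e : (s * f (g x)) • (f (g x))⁻¹ • g x + (t * f (g y)) • (f (g y))⁻¹ • g y =
        g (s • x + t • y) := by
      simp only [smul_smul, map_add, map_smul]
      rw [mul_assoc, mul_assoc, mul_inv_cancel₀ px.ne', mul_inv_cancel₀ py.ne', mul_one, mul_one]
    refine ⟨(f (g x))⁻¹ • g x, hCs _ (inv_pos.2 px) _ (gC x hx),
      (f (g y))⁻¹ • g y, hCs _ (inv_pos.2 py) _ (gC y hy),
      (f (g z))⁻¹ • g z, hCs _ (inv_pos.2 pz) _ (gC z hz), ?_, ?_, ?_,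
      s * f (g x), t * f (g y), by positivity, by positivity, ?_, ?_, ?_⟩
    · simp [px.ne']
    · simp [py.ne']
    · simp [pz.ne']
    · have := hS _ gu
      simpa using this
    · rw [e]; exact gu
    · intro a b ha hb hab
      rw [e]
      have cp : ∀ a b c d : ℝ, 0 ≤ a → 0 ≤ b → 0 < a + b → 0 < c → 0 < d →
          0 < a * c + b * d := by
        intro a b c d ha hb hab hc hd
        rcases ha.eq_or_lt with rfl | ha
        · have : 0 < b := by linarith
          positivity
        · positivity
      have e1 : a • (f (g x))⁻¹ • g x + b • (f (g z))⁻¹ • g z =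
          g ((a * (f (g x))⁻¹) • x + (b * (f (g z))⁻¹) • z) := by
        simp only [smul_smul, map_add, map_smul]
      have e2 : a • (f (g z))⁻¹ • g z + b • (f (g y))⁻¹ • g y =
          g ((a * (f (g z))⁻¹) • z + (b * (f (g y))⁻¹) • y) := by
        simp only [smul_smul, map_add, map_smul]
      rw [e1, e2, DD_map g gK, DD_map g gK]
      constructor
      · exact (h _ _ (by positivity) (by positivity)
          (cp a b _ _ ha hb hab (inv_pos.2 px) (inv_pos.2 pz))).1
      · exact (h _ _ (by positivity) (by positivity)
          (cp a b _ _ ha hb hab (inv_pos.2 pz) (inv_pos.2 py))).2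
  choose x hxC y hyC z hzC fx fy fz s t hs ht hst huQ hbig using norm1
  set Bs : Set E := closure {v ∈ K | f v = 1} with hBs
  have hBc : IsCompact Bs := Metric.isCompact_of_isClosed_isBounded isClosed_closure hb.closure
  set P : Set (E × E × E × ℝ × ℝ) := Bs ×ˢ Bs ×ˢ Bs ×ˢ Icc 0 S ×ˢ Icc 0 S with hP
  have hPc : IsCompact P :=
    hBc.prod (hBc.prod (hBc.prod (isCompact_Icc.prod isCompact_Icc)))
  have hin : ∀ n, (x n, y n, z n, s n, t n) ∈ P := fun n =>
    ⟨subset_closure ⟨hCK (hxC n), fx n⟩, subset_closure ⟨hCK (hyC n), fy n⟩,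
      subset_closure ⟨hCK (hzC n), fz n⟩, ⟨hs n, by linarith [hst n, ht n]⟩,
      ⟨ht n, by linarith [hst n, hs n]⟩⟩
  obtain ⟨⟨X, Y, Z, σ, τ⟩, hlim, φ, hφ, hconv⟩ := hPc.tendsto_subseq hin
  rw [Prod.tendsto_iff, Prod.tendsto_iff, Prod.tendsto_iff, Prod.tendsto_iff] at hconv
  obtain ⟨cx, cy, cz, cs, ct⟩ := hconv
  simp only [Function.comp_def] at cx cy cz cs ct
  have hσ : 0 ≤ σ := hlim.2.2.2.1.1
  have hτ : 0 ≤ τ := hlim.2.2.2.2.1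
  have clC : ∀ {w : ℕ → E} {W : E}, Tendsto (fun n => w (φ n)) atTop (nhds W) → (∀ n, w n ∈ C) →
      (∀ n, f (w n) = 1) → W ∈ closure C ∧ f W = 1 := by
    intro w W hw hwC hw1
    refine ⟨mem_closure_of_tendsto hw (Eventually.of_forall fun n => hwC _), ?_⟩
    have := (hfc.tendsto W).comp hw
    refine tendsto_nhds_unique this ?_
    simp [Function.comp_def, hw1]
  obtain ⟨hX, fX⟩ := clC cx hxC fx
  obtain ⟨hY, fY⟩ := clC cy hyC fy
  obtain ⟨hZ, fZ⟩ := clC cz hzC fz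
  have cu : Tendsto (fun n => s (φ n) • x (φ n) + t (φ n) • y (φ n)) atTop
      (nhds (σ • X + τ • Y)) := (cs.smul cx).add (ct.smul cy)
  have hU : σ • X + τ • Y ∈ Q :=
    hQ.isClosed.mem_of_tendsto cu (Eventually.of_forall fun n => huQ _)
  have hUK := hQK hU
  -- a limit of far away points is not in `K`
  have far : ∀ (q : ℕ → E) (q₀ : E), Tendsto q atTop (nhds q₀) → (∀ n, q n ∈ K) →
      (∀ n, (φ n : ℝ) < DD K (s (φ n) • x (φ n) + t (φ n) • y (φ n)) (q n)) → q₀ ∉ K := by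
    intro q q₀ hq hqK hd hq₀
    set l := max (MM K (σ • X + τ • Y) q₀) (MM K q₀ (σ • X + τ • Y)) + 1 with hl
    have m1 : l • q₀ - (σ • X + τ • Y) ∈ K :=
      (hK.mem_iff hUK hq₀).2 (by linarith [le_max_left (MM K (σ • X + τ • Y) q₀) (MM K q₀ (σ • X + τ • Y))])
    have m2 : l • (σ • X + τ • Y) - q₀ ∈ K :=
      (hK.mem_iff hq₀ hUK).2 (by linarith [le_max_right (MM K (σ • X + τ • Y) q₀) (MM K q₀ (σ • X + τ • Y))])
    have e1 := ((hq.const_smul l).sub cu).eventually (ho.mem_nhds m1)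
    have e2 := ((cu.const_smul l).sub hq).eventually (ho.mem_nhds m2)
    have e3 : ∀ᶠ n in atTop, Real.log l ≤ (φ n : ℝ) :=
      (tendsto_natCast_atTop_atTop.comp hφ.tendsto_atTop).eventually_ge_atTop _
    obtain ⟨n, ⟨h1, h2⟩, h3⟩ := ((e1.and e2).and e3).exists
    have := hK.DD_le (hQK (huQ (φ n))) (hqK n) h1 h2
    linarith [hd n]
  have n1 : ∀ a b : ℝ, 0 ≤ a → 0 ≤ b → 0 < a + b → a • X + b • Z ∉ K := fun a b ha hb hab =>
    far (fun n => a • x (φ n) + b • z (φ n)) _ ((cx.const_smul a).add (cz.const_smul b))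
      (fun n => hK.comb_mem (hCK (hxC _)) (hCK (hzC _)) ha hb hab)
      (fun n => (hbig (φ n) a b ha hb hab).1)
  have n2 : ∀ a b : ℝ, 0 ≤ a → 0 ≤ b → 0 < a + b → a • Z + b • Y ∉ K := fun a b ha hb hab =>
    far (fun n => a • z (φ n) + b • y (φ n)) _ ((cz.const_smul a).add (cy.const_smul b))
      (fun n => hK.comb_mem (hCK (hzC _)) (hCK (hyC _)) ha hb hab)
      (fun n => (hbig (φ n) a b ha hb hab).2)
  obtain ⟨L₁, h1⟩ := H X hX Z hZ fX fZ n1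
  obtain ⟨L₂, h2⟩ := H Z hZ Y hY fZ fY n2
  have fpos : ∀ v ∈ closure K, 0 ≤ f v := by
    intro v hv
    have : closure K ⊆ {v | 0 ≤ f v} :=
      closure_minimal (fun v hv => (hK.pos v hv).le) (isClosed_le continuous_const hfc)
    exact this hv
  have hL2 : 1 ≤ L₂ := by
    have := fpos _ h2
    simp [fZ, fY] at this
    exact this
  have h3 : (L₁ * L₂) • X - Y ∈ closure K := by
    have := hK.closure_add (hK.closure_smul h1 (show 0 < L₂ by linarith)) h2
    convert this using 1; module
  have hXY : (σ + τ * (L₁ * L₂)) • X ∈ K := by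
    rcases hτ.eq_or_lt with h0 | h0
    · rw [← h0] at hUK ⊢
      simpa using hUK
    · have := hK.closure_add_mem ho (hK.closure_smul h3 h0) hUK
      convert this using 1; module
  have hp := hK.pos _ hXY
  simp only [map_smul, fX, smul_eq_mul, mul_one] at hp
  exact n1 _ 0 hp.le le_rfl (by linarith) (by simpa using hXY)

end ConeTop

section Proj

theorem chartMap_mk (f : (Fin d → ℝ) →ₗ[ℝ] ℝ) (v : Fin d → ℝ) (hv : v ≠ 0) :
    chartMap f (Projectivization.mk ℝ v hv) = (f v)⁻¹ • v := by
  obtain ⟨a, ha⟩ := Projectivization.exists_smul_eq_mk_rep ℝ v hv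
  have ha' : (a : ℝ) • v = (Projectivization.mk ℝ v hv).rep := ha
  have ha0 : (a : ℝ) ≠ 0 := a.ne_zero
  rw [chartMap, ← ha', map_smul, smul_smul, smul_eq_mul, mul_inv]
  congr 1
  field_simp

theorem f_mk_ne (f : (Fin d → ℝ) →ₗ[ℝ] ℝ) (v : Fin d → ℝ) (hv : v ≠ 0) :
    f (Projectivization.mk ℝ v hv).rep ≠ 0 ↔ f v ≠ 0 := by
  obtain ⟨a, ha⟩ := Projectivization.exists_smul_eq_mk_rep ℝ v hv
  have ha' : (a : ℝ) • v = (Projectivization.mk ℝ v hv).rep := ha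
  have ha0 : (a : ℝ) ≠ 0 := a.ne_zero
  rw [← ha', map_smul, smul_eq_mul]
  simp [ha0]

theorem mk_smul_eq (v : Fin d → ℝ) (hv : v ≠ 0) (c : ℝ) (h : c • v ≠ 0) :
    Projectivization.mk ℝ (c • v) h = Projectivization.mk ℝ v hv := by
  rw [Projectivization.mk_eq_mk_iff']
  exact ⟨c, rfl⟩

theorem mk_neg_eq (v : Fin d → ℝ) (hv : v ≠ 0) (h : -v ≠ 0) :
    Projectivization.mk ℝ (-v) h = Projectivization.mk ℝ v hv := by
  rw [Projectivization.mk_eq_mk_iff']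
  exact ⟨-1, by simp⟩

def pim (v : {v : Fin d → ℝ // v ≠ 0}) : PSpace d := Projectivization.mk ℝ v.1 v.2

theorem pim_quot : Topology.IsQuotientMap (pim (d := d)) :=
  isQuotientMap_quotient_mk' (s := projectivizationSetoid ℝ (Fin d → ℝ))

theorem isOpen_val_image {s : Set {v : Fin d → ℝ // v ≠ 0}} (hs : IsOpen s) :
    IsOpen (Subtype.val '' s) :=
  (isOpen_ne (x := (0 : Fin d → ℝ))).isOpenMap_subtype_val _ hs

theorem chartMap_contOn (f : (Fin d → ℝ) →ₗ[ℝ] ℝ) :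
    ContinuousOn (chartMap f) {p : PSpace d | f p.rep ≠ 0} := by
  have hfc : Continuous f := f.continuous_of_finiteDimensional
  have hg : ContinuousOn (fun v : {v : Fin d → ℝ // v ≠ 0} => (f v.1)⁻¹ • v.1) {v | f v.1 ≠ 0} :=
    ContinuousOn.smul (ContinuousOn.inv₀ (by fun_prop) (fun v hv => hv)) (by fun_prop)
  have ho1 : IsOpen {v : {v : Fin d → ℝ // v ≠ 0} | f v.1 ≠ 0} :=
    isOpen_ne_fun (by fun_prop) continuous_const
  have e1 : pim ⁻¹' {p : PSpace d | f p.rep ≠ 0} = {v : {v : Fin d → ℝ // v ≠ 0} | f v.1 ≠ 0} := by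
    ext v
    exact f_mk_ne f v.1 v.2
  have hU : IsOpen {p : PSpace d | f p.rep ≠ 0} := by
    rw [← pim_quot.isOpen_preimage, e1]; exact ho1
  rw [continuousOn_open_iff hU]
  intro t ht
  rw [← pim_quot.isOpen_preimage, preimage_inter, e1]
  have := (continuousOn_open_iff ho1).1 hg t ht
  convert this using 2
  ext v
  simp only [mem_preimage, pim, chartMap_mk]

/-- The cone over a subset of projective space. -/
def Kc (f : (Fin d → ℝ) →ₗ[ℝ] ℝ) (A : Set (PSpace d)) : Set (Fin d → ℝ) :=
  {v | 0 < f v ∧ ∃ h : v ≠ 0, Projectivization.mk ℝ v h ∈ A}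

theorem ne_of_f {f : (Fin d → ℝ) →ₗ[ℝ] ℝ} {v : Fin d → ℝ} (h : f v ≠ 0) : v ≠ 0 := by
  rintro rfl; simp at h

theorem Kc_smul (f : (Fin d → ℝ) →ₗ[ℝ] ℝ) (A : Set (PSpace d)) (c : ℝ) (hc : 0 < c)
    (v : Fin d → ℝ) (hv : v ∈ Kc f A) : c • v ∈ Kc f A := by
  obtain ⟨h1, h2, h3⟩ := hv
  refine ⟨by simpa using mul_pos hc h1, smul_ne_zero hc.ne' h2, ?_⟩
  rwa [mk_smul_eq v h2]

theorem chartMap_mem_Kc {f : (Fin d → ℝ) →ₗ[ℝ] ℝ} {A : Set (PSpace d)} {x : PSpace d}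
    (hx : x ∈ A) (hf : f x.rep ≠ 0) :
    chartMap f x ∈ Kc f A ∧ f (chartMap f x) = 1 ∧
      ∃ h, Projectivization.mk ℝ (chartMap f x) h = x := by
  have h1 : f (chartMap f x) = 1 := by simp [chartMap, hf]
  have h0 : chartMap f x ≠ 0 := ne_of_f (f := f) (by rw [h1]; simp)
  have h2 : Projectivization.mk ℝ (chartMap f x) h0 = x := by
    conv_rhs => rw [← Projectivization.mk_rep x]
    exact mk_smul_eq _ (Projectivization.rep_nonzero x) _ _
  exact ⟨⟨by rw [h1]; simp, h0, by rwa [h2]⟩, h1, h0, h2⟩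

theorem Kc_base {f : (Fin d → ℝ) →ₗ[ℝ] ℝ} {A : Set (PSpace d)} {v : Fin d → ℝ}
    (hA : ∀ x ∈ A, f x.rep ≠ 0) (hv : f v = 1) : v ∈ Kc f A ↔ v ∈ chartMap f '' A := by
  constructor
  · rintro ⟨_, h, h'⟩
    exact ⟨_, h', by rw [chartMap_mk, hv]; simp⟩
  · rintro ⟨x, hx, rfl⟩
    exact (chartMap_mem_Kc hx (hA x hx)).1

theorem Kc_add {f : (Fin d → ℝ) →ₗ[ℝ] ℝ} {A : Set (PSpace d)}
    (hA : ∀ x ∈ A, f x.rep ≠ 0) (hc : Convex ℝ (chartMap f '' A))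
    (u : Fin d → ℝ) (hu : u ∈ Kc f A) (v : Fin d → ℝ) (hv : v ∈ Kc f A) : u + v ∈ Kc f A := by
  have pu := hu.1
  have pv := hv.1
  have hu1 := (Kc_base hA (by simp [pu.ne'])).1 (Kc_smul f A (f u)⁻¹ (by positivity) u hu)
  have hv1 := (Kc_base hA (by simp [pv.ne'])).1 (Kc_smul f A (f v)⁻¹ (by positivity) v hv)
  have hp : 0 < f u + f v := by positivity
  have := hc hu1 hv1 (a := f u / (f u + f v)) (b := f v / (f u + f v)) (by positivity)
    (by positivity) (by field_simp)
  rw [← Kc_base hA] at this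
  · have := Kc_smul f A (f u + f v) hp _ this
    convert this using 1
    simp only [smul_add, smul_smul]
    have e1 : (f u + f v) * (f u / (f u + f v) * (f u)⁻¹) = 1 := by field_simp
    have e2 : (f u + f v) * (f v / (f u + f v) * (f v)⁻¹) = 1 := by field_simp
    first | rw [e1, e2] | rw [mul_assoc, mul_assoc, e1, e2]
    simp
  · simp only [map_add, map_smul, smul_eq_mul]
    field_simp

theorem Kc_open {f : (Fin d → ℝ) →ₗ[ℝ] ℝ} {A : Set (PSpace d)} (ho : IsOpen A) :
    IsOpen (Kc f A) := by
  have hfc : Continuous f := f.continuous_of_finiteDimensional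
  have : Kc f A = {v | 0 < f v} ∩ Subtype.val '' (pim ⁻¹' A) := by
    ext v
    constructor
    · rintro ⟨h, h1, h2⟩
      exact ⟨h, ⟨v, h1⟩, h2, rfl⟩
    · rintro ⟨h, ⟨w, h1⟩, h2, rfl⟩
      exact ⟨h, h1, h2⟩
  rw [this]
  exact (isOpen_lt continuous_const hfc).inter (isOpen_val_image (ho.preimage pim_quot.continuous))

theorem mk_mem_closure {f : (Fin d → ℝ) →ₗ[ℝ] ℝ} {A : Set (PSpace d)} {v : Fin d → ℝ}
    (hv : v ∈ closure (Kc f A)) (h0 : v ≠ 0) : Projectivization.mk ℝ v h0 ∈ closure A := by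
  rw [mem_closure_iff]
  intro N hN hvN
  have h1 := isOpen_val_image (hN.preimage (pim_quot (d := d)).continuous)
  obtain ⟨u, ⟨⟨u', hu'⟩, huN, rfl⟩, -, h2, h3⟩ := mem_closure_iff.1 hv _ h1 ⟨⟨v, h0⟩, hvN, rfl⟩
  exact ⟨_, huN, h3⟩

theorem chartMap_mem_closure {f : (Fin d → ℝ) →ₗ[ℝ] ℝ} {A : Set (PSpace d)}
    (hA : ∀ x ∈ closure A, f x.rep ≠ 0) {x : PSpace d} (hx : x ∈ closure A) :
    chartMap f x ∈ closure (chartMap f '' A) := by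
  have h1 : ContinuousOn (chartMap f) (closure A) := (chartMap_contOn f).mono hA
  exact h1.image_closure ⟨x, hx, rfl⟩

theorem chart_spec {S : Set (PSpace d)} (hS : IsProperlyConvex S) :
    (∀ x ∈ closure S, chartOf S x.rep ≠ 0) ∧ Convex ℝ (cmap S '' S) ∧
      Bornology.IsBounded (cmap S '' S) := by
  have : chartOf S = hS.choose := by simp [chartOf, hS]
  rw [cmap, this]
  exact hS.choose_spec

theorem hilbert_eq {S : Set (PSpace d)} (hS : IsProperlyConvex S) {K : Set (Fin d → ℝ)}
    {φ : (Fin d → ℝ) →ₗ[ℝ] ℝ} (hK : ConeS K φ)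
    (hKS : ∀ v (hv : v ≠ 0), Projectivization.mk ℝ v hv ∈ S ↔ v ∈ K ∨ -v ∈ K)
    {u v : Fin d → ℝ} (hu : u ∈ K) (hv : v ∈ K) (hu0 : u ≠ 0) (hv0 : v ≠ 0) :
    hilbertDist S (Projectivization.mk ℝ u hu0) (Projectivization.mk ℝ v hv0) = DD K u v := by
  obtain ⟨hf, hconv, hbd⟩ := chart_spec hS
  rw [hilbertDist]
  rw [cmap] at *
  set f := chartOf S
  have n0 : ∀ v ∈ K, v ≠ 0 := fun v hv => ne_of_f (hK.pos v hv).ne'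
  have fK : ∀ v ∈ K, f v ≠ 0 := fun v hv =>
    (f_mk_ne f v (n0 v hv)).1 (hf _ (subset_closure ((hKS v (n0 v hv)).2 (Or.inl hv))))
  obtain ⟨ε, hε, hpos⟩ : ∃ ε : ℝ, (ε = 1 ∨ ε = -1) ∧ ∀ v ∈ K, 0 < ε * f v := by
    have same : ∀ u ∈ K, ∀ v ∈ K, 0 < f u → f v < 0 → False := by
      intro u hu v hv h1 h2
      have := hK.add _ (hK.smul (f u) h1 v hv) _ (hK.smul (-f v) (by linarith) u hu)
      apply fK _ this
      simp; ring
    rcases lt_or_gt_of_ne (fK u hu) with h | h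
    · refine ⟨-1, Or.inr rfl, fun w hw => ?_⟩
      rcases lt_or_gt_of_ne (fK w hw) with h' | h'
      · linarith
      · exact (same w hw u hu h' h).elim
    · refine ⟨1, Or.inl rfl, fun w hw => ?_⟩
      rcases lt_or_gt_of_ne (fK w hw) with h' | h'
      · exact (same u hu w hw h h').elim
      · linarith
  have εε : ε * ε = 1 := by rcases hε with rfl | rfl <;> norm_num
  have hK' : ConeS K (ε • f) := ⟨hK.smul, hK.add, hK.op, fun v hv => by simpa using hpos v hv⟩
  -- the chart image in terms of the cone
  have hO : ∀ w, f w = 1 → (w ∈ chartMap f '' S ↔ ε • w ∈ K) := by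
    intro w hw
    constructor
    · rintro ⟨x, hx, rfl⟩
      have hx' := hx
      rw [← Projectivization.mk_rep x, hKS] at hx'
      rw [chartMap, smul_smul]
      rcases hx' with h | h
      · have := hpos _ h
        have h2 := hK.smul (ε * f x.rep)⁻¹ (by positivity) _ h
        rwa [mul_inv, show ε⁻¹ = ε from inv_eq_of_mul_eq_one_left εε] at h2
      · have := hpos _ h
        have h2 := hK.smul (ε * f (-x.rep))⁻¹ (by positivity) _ h
        rw [mul_inv, show ε⁻¹ = ε from inv_eq_of_mul_eq_one_left εε] at h2
        simpa using h2
    · intro h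
      have hw0 : w ≠ 0 := ne_of_f (f := f) (by rw [hw]; simp)
      refine ⟨Projectivization.mk ℝ w hw0, ?_, by rw [chartMap_mk, hw]; simp⟩
      rw [hKS]
      rcases hε with rfl | rfl
      · left; simpa using h
      · right; simpa using h
  have hb : Bornology.IsBounded {v ∈ K | (ε • f) v = 1} := by
    obtain ⟨B, hB⟩ := hbd.exists_norm_le
    rw [isBounded_iff_forall_norm_le]
    refine ⟨B, fun w hw => ?_⟩
    have h1 : f (ε • w) = 1 := by simpa using hw.2
    have h2 : ε • w ∈ chartMap f '' S := by
      rw [hO _ h1, smul_smul, εε, one_smul]; exact hw.1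
    have h3 := hB _ h2
    rw [norm_smul] at h3
    rcases hε with rfl | rfl <;> simpa using h3
  have pu := hpos u hu
  have pv := hpos v hv
  set u' := (ε * f u)⁻¹ • u with hu'
  set v' := (ε * f v)⁻¹ • v with hv'
  have hu'K : u' ∈ K := hK.smul _ (by positivity) u hu
  have hv'K : v' ∈ K := hK.smul _ (by positivity) v hv
  have εi : ε⁻¹ = ε := inv_eq_of_mul_eq_one_left εε
  have ε0 : ε ≠ 0 := by rcases hε with rfl | rfl <;> norm_num
  have eu : (f u)⁻¹ • u = ε • u' := by
    rw [hu', smul_smul, mul_inv, ← mul_assoc, mul_inv_cancel₀ ε0, one_mul]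
  have ev : (f v)⁻¹ • v = ε • v' := by
    rw [hv', smul_smul, mul_inv, ← mul_assoc, mul_inv_cancel₀ ε0, one_mul]
  have fu' : (ε • f) u' = 1 := by
    simp only [hu', map_smul, LinearMap.smul_apply, smul_eq_mul]; exact inv_mul_cancel₀ pu.ne'
  have fv' : (ε • f) v' = 1 := by
    simp only [hv', map_smul, LinearMap.smul_apply, smul_eq_mul]; exact inv_mul_cancel₀ pv.ne'
  have hset : {t : ℝ | ε • u' + t • (ε • v' - ε • u') ∈ chartMap f '' S} =
      {t : ℝ | u' + t • (v' - u') ∈ K} := by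
    ext t
    have e : ε • u' + t • (ε • v' - ε • u') = ε • (u' + t • (v' - u')) := by module
    have e1 : f (ε • (u' + t • (v' - u'))) = 1 := by
      have h1 : ε * f u' = 1 := by simpa using fu'
      have h2 : ε * f v' = 1 := by simpa using fv'
      simp only [map_smul, map_add, map_sub, smul_eq_mul]
      linear_combination (1 - t) * h1 + t * h2
    simp only [mem_ofPred_eq]
    rw [e, hO _ e1, smul_smul, εε, one_smul]
  rw [chartMap_mk, chartMap_mk, eu, ev, hilbertDistChart, hset]
  have hD : DD K u v = DD K u' v' :=
    (hK.DD_smul hu hv (by positivity) (by positivity)).symm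
  split_ifs with h
  · have : u' = v' := smul_right_injective _ ε0 h
    rw [hD, this, hK.DD_self hv'K]
  · have huv : u' ≠ v' := fun h' => h (by rw [h'])
    rw [hD]
    exact hK'.cross_dist hu'K hv'K (hK'.one_lt hb hu'K hv'K fu' fv' huv)
      (hK'.one_lt hb hv'K hu'K fv' fu' huv.symm)

end Proj

section Face

/-- The cone over the open face of `w`. -/
def KF (K : Set (Fin d → ℝ)) (w : Fin d → ℝ) : Set (Fin d → ℝ) :=
  {v | v ∈ closure K ∧ (∃ L : ℝ, 0 < L ∧ L • v - w ∈ closure K) ∧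
    ∃ L : ℝ, 0 < L ∧ L • w - v ∈ closure K}

variable {K : Set (Fin d → ℝ)} {f : (Fin d → ℝ) →ₗ[ℝ] ℝ}

theorem ConeS.closure_f (hK : ConeS K f) {v : Fin d → ℝ} (hv : v ∈ closure K) : 0 ≤ f v := by
  have hfc : Continuous f := f.continuous_of_finiteDimensional
  have : closure K ⊆ {v | 0 ≤ f v} :=
    closure_minimal (fun v hv => (hK.pos v hv).le) (isClosed_le continuous_const hfc)
  exact this hv

theorem ConeS.KF_cone (hK : ConeS K f) {w : Fin d → ℝ} (fw : f w = 1) : ConeS (KF K w) f := by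
  refine ⟨?_, ?_, ?_, ?_⟩
  · rintro c hc v ⟨h1, ⟨L, hL, h2⟩, M, hM, h3⟩
    refine ⟨hK.closure_smul h1 hc, ⟨L / c, by positivity, ?_⟩, M * c, by positivity, ?_⟩
    · rwa [smul_smul, div_mul_cancel₀ _ hc.ne']
    · have := hK.closure_smul h3 hc
      convert this using 1; module
  · rintro u ⟨h1, ⟨L, hL, h2⟩, M, hM, h3⟩ v ⟨h1', ⟨L', hL', h2'⟩, M', hM', h3'⟩
    refine ⟨hK.closure_add h1 h1', ⟨L, hL, ?_⟩, M + M', by positivity, ?_⟩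
    · have := hK.closure_add h2 (hK.closure_smul h1' hL)
      convert this using 1; module
    · have := hK.closure_add h3 h3'
      convert this using 1; module
  · rintro u ⟨h1, ⟨L, hL, h2⟩, M, hM, h3⟩ v ⟨h1', ⟨L', hL', h2'⟩, M', hM', h3'⟩
    have k : (L * M') • u - v ∈ closure K := by
      have := hK.closure_add (hK.closure_smul h2 hM') h3'
      convert this using 1; module
    set ε := 1 / (2 * (L * M')) with hε
    have e0 : 0 < ε := by positivity
    have e1 : ε * (L * M') = 1 / 2 := by rw [hε]; field_simp
    have e2 : u - ε • v = (1 / 2 : ℝ) • u + ε • ((L * M') • u - v) := by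
      rw [smul_sub, smul_smul, e1]; module
    refine ⟨ε, e0, ?_, ⟨2 * L, by positivity, ?_⟩, M, hM, ?_⟩
    · rw [e2]
      exact hK.closure_add (hK.closure_smul h1 (by norm_num)) (hK.closure_smul k e0)
    · rw [e2]
      have := hK.closure_add h2 (hK.closure_smul k (show 0 < 2 * L * ε by positivity))
      convert this using 1; module
    · have := hK.closure_add h3 (hK.closure_smul h1' e0)
      convert this using 1; module
  · rintro v ⟨h1, ⟨L, hL, h2⟩, -⟩
    have := hK.closure_f h2
    simp only [map_sub, map_smul, smul_eq_mul, fw] at this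
    by_contra h
    push Not at h
    nlinarith

theorem ConeS.dom_of_seg (hK : ConeS K f) {a b p q : Fin d → ℝ} (ha : a ∈ closure K)
    (hb : b ∈ closure K) (hp : p ∈ openSegment ℝ a b) (hq : q ∈ openSegment ℝ a b) :
    ∃ L : ℝ, 0 < L ∧ L • p - q ∈ closure K := by
  obtain ⟨s, t, hs, ht, hst, rfl⟩ := hp
  obtain ⟨s', t', hs', ht', hst', rfl⟩ := hq
  refine ⟨1 / s + 1 / t, by positivity, ?_⟩
  have c1 : 0 < (1 / s + 1 / t) * s - s' := by
    have : (1 / s + 1 / t) * s = 1 + s / t := by field_simp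
    have : 0 < s / t := by positivity
    linarith
  have c2 : 0 < (1 / s + 1 / t) * t - t' := by
    have : (1 / s + 1 / t) * t = 1 + t / s := by field_simp; ring
    have : 0 < t / s := by positivity
    linarith
  have := hK.closure_add (hK.closure_smul ha c1) (hK.closure_smul hb c2)
  convert this using 1; module

theorem ConeS.KF_of_seg (hK : ConeS K f) {a b p q : Fin d → ℝ} (ha : a ∈ closure K)
    (hb : b ∈ closure K) (hp : p ∈ openSegment ℝ a b) (hq : q ∈ openSegment ℝ a b) :
    q ∈ KF K p := by
  refine ⟨?_, hK.dom_of_seg ha hb hq hp, hK.dom_of_seg ha hb hp hq⟩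
  obtain ⟨s', t', hs', ht', hst', rfl⟩ := hq
  exact hK.closure_add (hK.closure_smul ha hs') (hK.closure_smul hb ht')

theorem KF_self (hK : ConeS K f) {w : Fin d → ℝ} (hw : w ∈ closure K) : w ∈ KF K w :=
  hK.KF_of_seg hw hw (by simp [openSegment_same]) (by simp [openSegment_same])

variable {Ω : Set (PSpace d)}

theorem Omega_mem (hf : ∀ x ∈ Ω, f x.rep ≠ 0) (v : Fin d → ℝ) (hv : v ≠ 0) :
    Projectivization.mk ℝ v hv ∈ Ω ↔ v ∈ Kc f Ω ∨ -v ∈ Kc f Ω := by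
  constructor
  · intro h
    have := (f_mk_ne f v hv).1 (hf _ h)
    rcases lt_or_gt_of_ne this with h' | h'
    · right
      exact ⟨by simpa using h', neg_ne_zero.2 hv, by rwa [mk_neg_eq v hv]⟩
    · left
      exact ⟨h', hv, h⟩
  · rintro (⟨_, h, h'⟩ | ⟨_, h, h'⟩)
    · exact h'
    · rwa [mk_neg_eq v hv] at h'

theorem Omega_cone (hΩ : IsProperlyConvex Ω) (ho : IsOpen Ω) :
    ConeS (Kc (chartOf Ω) Ω) (chartOf Ω) := by
  obtain ⟨hf, hc, hb⟩ := chart_spec hΩ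
  exact ConeS.ofOpen (Kc_smul _ _) (Kc_add (fun x hx => hf x (subset_closure hx)) hc)
    (fun v hv => hv.1) (Kc_open ho)

theorem cmap_closure (hΩ : IsProperlyConvex Ω) {x : PSpace d} (hx : x ∈ closure Ω) :
    cmap Ω x ∈ closure (Kc (chartOf Ω) Ω) := by
  obtain ⟨hf, hc, hb⟩ := chart_spec hΩ
  refine closure_mono ?_ (chartMap_mem_closure hf hx)
  rintro _ ⟨y, hy, rfl⟩
  exact (chartMap_mem_Kc hy (hf y (subset_closure hy))).1

theorem face_sub {W : PSpace d} (hW : W ∈ closure Ω) : face Ω W ⊆ closure Ω := by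
  rintro y (rfl | ⟨h, -⟩)
  · exact hW
  · exact h

theorem face_mem (hΩ : IsProperlyConvex Ω) (ho : IsOpen Ω) {w : Fin d → ℝ} (hw0 : w ≠ 0)
    (hw : w ∈ closure (Kc (chartOf Ω) Ω)) (fw : chartOf Ω w = 1) (v : Fin d → ℝ) (hv : v ≠ 0) :
    Projectivization.mk ℝ v hv ∈ face Ω (Projectivization.mk ℝ w hw0) ↔
      v ∈ KF (Kc (chartOf Ω) Ω) w ∨ -v ∈ KF (Kc (chartOf Ω) Ω) w := by
  obtain ⟨hf, hc, hb⟩ := chart_spec hΩ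
  have hK := Omega_cone hΩ ho
  have hW : Projectivization.mk ℝ w hw0 ∈ closure Ω := mk_mem_closure hw hw0
  have hcw : cmap Ω (Projectivization.mk ℝ w hw0) = w := by
    rw [cmap, chartMap_mk, fw]; simp
  have hKF := hK.KF_cone fw
  constructor
  · intro h
    have fv : chartOf Ω v ≠ 0 := (f_mk_ne _ v hv).1 (hf _ (face_sub hW h))
    have key : (chartOf Ω v)⁻¹ • v ∈ KF (Kc (chartOf Ω) Ω) w := by
      rw [← chartMap_mk _ v hv]
      rcases h with h | ⟨h, a, ha, b, hb, h1, h2⟩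
      · rw [h]
        change cmap Ω _ ∈ _
        rw [hcw]
        exact KF_self hK hw
      · have h1' := h1.2
        rw [hcw] at h1'
        exact hK.KF_of_seg (cmap_closure hΩ ha) (cmap_closure hΩ hb) h1' h2.2
    rcases lt_or_gt_of_ne fv with h' | h'
    · right
      have := hKF.smul (-chartOf Ω v) (by linarith) _ key
      rwa [smul_smul, neg_mul, mul_inv_cancel₀ fv, neg_one_smul] at this
    · left
      have := hKF.smul (chartOf Ω v) h' _ key
      rwa [smul_smul, mul_inv_cancel₀ fv, one_smul] at this
  · have main : ∀ v (hv : v ≠ 0), v ∈ KF (Kc (chartOf Ω) Ω) w →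
        Projectivization.mk ℝ v hv ∈ face Ω (Projectivization.mk ℝ w hw0) := by
      intro v hv h
      have fv := hKF.pos v h
      obtain ⟨h1, ⟨L, hL, h2⟩, M, hM, h3⟩ := hKF.smul (chartOf Ω v)⁻¹ (by positivity) _ h
      have hcv : cmap Ω (Projectivization.mk ℝ v hv) = (chartOf Ω v)⁻¹ • v := by
        rw [cmap, chartMap_mk]
      set v' := (chartOf Ω v)⁻¹ • v
      have fv' : chartOf Ω v' = 1 := by simp [v', fv.ne']
      set N := L + M + 1 with hN
      have hN1 : 0 < N - 1 := by linarith
      have hN2 : 0 < N + 1 := by linarith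
      have hN2q : N + 1 ≠ 0 := hN2.ne'
      have hN1q : N - 1 ≠ 0 := hN1.ne'
      have ha : (N - 1)⁻¹ • (N • w - v') ∈ closure (Kc (chartOf Ω) Ω) := by
        refine hK.closure_smul ?_ (by positivity)
        have := hK.closure_add h3 (hK.closure_smul hw (show 0 < L + 1 by linarith))
        convert this using 1; module
      have hb : (N - 1)⁻¹ • (N • v' - w) ∈ closure (Kc (chartOf Ω) Ω) := by
        refine hK.closure_smul ?_ (by positivity)
        have := hK.closure_add h2 (hK.closure_smul h1 (show 0 < M + 1 by linarith))
        convert this using 1; module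
      have fa : chartOf Ω ((N - 1)⁻¹ • (N • w - v')) = 1 := by
        simp only [map_smul, map_sub, fw, fv', smul_eq_mul, mul_one]
        field_simp
      have fb : chartOf Ω ((N - 1)⁻¹ • (N • v' - w)) = 1 := by
        simp only [map_smul, map_sub, fw, fv', smul_eq_mul, mul_one]
        field_simp
      have ha0 := ne_of_f (f := chartOf Ω) (by rw [fa]; exact one_ne_zero)
      have hb0 := ne_of_f (f := chartOf Ω) (by rw [fb]; exact one_ne_zero)
      have hvc : Projectivization.mk ℝ v hv ∈ closure Ω := mk_mem_closure h.1 hv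
      have ca : cmap Ω (Projectivization.mk ℝ _ ha0) = (N - 1)⁻¹ • (N • w - v') := by
        rw [cmap, chartMap_mk, fa, inv_one, one_smul]
      have cb : cmap Ω (Projectivization.mk ℝ _ hb0) = (N - 1)⁻¹ • (N • v' - w) := by
        rw [cmap, chartMap_mk, fb, inv_one, one_smul]
      have i1 : N / (N + 1) * (N - 1)⁻¹ * N - 1 / (N + 1) * (N - 1)⁻¹ = 1 := by
        field_simp; ring
      have i2 : 1 / (N + 1) * (N - 1)⁻¹ * N - N / (N + 1) * (N - 1)⁻¹ = 0 := by
        field_simp; ring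
      right
      refine ⟨hvc, _, mk_mem_closure ha ha0, _, mk_mem_closure hb hb0, ⟨hW, ?_⟩, hvc, ?_⟩
      · rw [ca, cb, hcw]
        refine ⟨N / (N + 1), 1 / (N + 1), by positivity, by positivity, by field_simp, ?_⟩
        have : (N / (N + 1)) • (N - 1)⁻¹ • (N • w - v') + (1 / (N + 1)) • (N - 1)⁻¹ • (N • v' - w)
          = (N / (N + 1) * (N - 1)⁻¹ * N - 1 / (N + 1) * (N - 1)⁻¹) • w +
            (1 / (N + 1) * (N - 1)⁻¹ * N - N / (N + 1) * (N - 1)⁻¹) • v' := by module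
        rw [this, i1, i2]; simp
      · rw [ca, cb, hcv]
        refine ⟨1 / (N + 1), N / (N + 1), by positivity, by positivity, by field_simp; ring, ?_⟩
        have : (1 / (N + 1)) • (N - 1)⁻¹ • (N • w - v') + (N / (N + 1)) • (N - 1)⁻¹ • (N • v' - w)
          = (N / (N + 1) * (N - 1)⁻¹ * N - 1 / (N + 1) * (N - 1)⁻¹) • v' +
            (1 / (N + 1) * (N - 1)⁻¹ * N - N / (N + 1) * (N - 1)⁻¹) • w := by module
        rw [this, i1, i2]; simp
    rintro (h | h)
    · exact main v hv h
    · have := main (-v) (neg_ne_zero.2 hv) h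
      rwa [mk_neg_eq v hv] at this

theorem face_pc (hΩ : IsProperlyConvex Ω) (ho : IsOpen Ω) {w : Fin d → ℝ} (hw0 : w ≠ 0)
    (hw : w ∈ closure (Kc (chartOf Ω) Ω)) (fw : chartOf Ω w = 1) :
    IsProperlyConvex (face Ω (Projectivization.mk ℝ w hw0)) := by
  obtain ⟨hf, hc, hb⟩ := chart_spec hΩ
  have hK := Omega_cone hΩ ho
  have hW : Projectivization.mk ℝ w hw0 ∈ closure Ω := mk_mem_closure hw hw0
  have hKF := hK.KF_cone fw
  have hsub := face_sub hW
  have hne : ∀ x ∈ face Ω (Projectivization.mk ℝ w hw0), chartOf Ω x.rep ≠ 0 :=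
    fun x hx => hf x (hsub hx)
  have himg : chartMap (chartOf Ω) '' face Ω (Projectivization.mk ℝ w hw0) =
      {v | v ∈ KF (Kc (chartOf Ω) Ω) w ∧ chartOf Ω v = 1} := by
    ext v
    constructor
    · rintro ⟨x, hx, rfl⟩
      obtain ⟨h1, h2, h3, h4⟩ := chartMap_mem_Kc hx (hne x hx)
      refine ⟨?_, h2⟩
      rw [← h4, face_mem hΩ ho hw0 hw fw] at hx
      rcases hx with h | h
      · exact h
      · have := hKF.pos _ h
        rw [map_neg, h2] at this
        linarith
    · rintro ⟨h1, h2⟩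
      have h0 : v ≠ 0 := ne_of_f (f := chartOf Ω) (by rw [h2]; simp)
      exact ⟨_, (face_mem hΩ ho hw0 hw fw v h0).2 (Or.inl h1), by rw [chartMap_mk, h2]; simp⟩
  refine ⟨chartOf Ω, fun x hx => hf x (closure_minimal hsub isClosed_closure hx), ?_, ?_⟩
  · rw [himg]
    rintro u ⟨hu, fu⟩ v ⟨hv, fv⟩ a b ha hb hab
    exact ⟨hKF.comb_mem hu hv ha hb (by linarith), by simp [fu, fv, hab]⟩
  · refine hb.closure.subset ?_
    rintro _ ⟨x, hx, rfl⟩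
    exact chartMap_mem_closure hf (hsub hx)

end Face

section Main

theorem NCC_H (T : NCCTriple d)
    (h : ∀ x ∈ idealBdry T.C, cdim (face T.Ω x) (idealBdry T.C ∩ face T.Ω x) = 0)
    (x : Fin d → ℝ) (hx : x ∈ closure (Kc (chartOf T.Ω) T.C))
    (z : Fin d → ℝ) (hz : z ∈ closure (Kc (chartOf T.Ω) T.C))
    (fx : chartOf T.Ω x = 1) (fz : chartOf T.Ω z = 1)
    (hn : ∀ a b : ℝ, 0 ≤ a → 0 ≤ b → 0 < a + b → a • x + b • z ∉ Kc (chartOf T.Ω) T.Ω) :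
    ∃ L : ℝ, L • x - z ∈ closure (Kc (chartOf T.Ω) T.Ω) := by
  have hΩ := T.properlyConvex_Ω
  have ho := T.isOpen_Ω
  obtain ⟨hf, hc, hb⟩ := chart_spec hΩ
  have hK := Omega_cone hΩ ho
  set f := chartOf T.Ω with hfdef
  set K := Kc f T.Ω with hKdef
  have hfC : ∀ x ∈ T.C, f x.rep ≠ 0 := fun x hx => hf x (subset_closure (T.C_sub hx))
  have hCs := Kc_smul f T.C
  have hCa := Kc_add hfC T.C_convex
  have hCK : Kc f T.C ⊆ K := fun v hv => ⟨hv.1, hv.2.1, T.C_sub hv.2.2⟩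
  have hxK := closure_mono hCK hx
  have hzK := closure_mono hCK hz
  -- points of the open segment
  have seg : ∀ s : ℝ, 0 < s → s < 1 → (1 - s) • x + s • z ∈ closure (Kc f T.C) := by
    intro s h0 h1
    refine map_mem_closure₂ (f := fun x z => (1 - s) • x + s • z) (by fun_prop) hx hz ?_
    intro a ha b hb
    exact hCa _ (hCs _ (by linarith) _ ha) _ (hCs _ h0 _ hb)
  have fseg : ∀ s : ℝ, f ((1 - s) • x + s • z) = 1 := by
    intro s; simp [fx, fz]
  have seg0 : ∀ s : ℝ, (1 - s) • x + s • z ≠ 0 := fun s =>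
    ne_of_f (f := f) (by rw [fseg s]; simp)
  have segB : ∀ s : ℝ, 0 < s → s < 1 → Projectivization.mk ℝ _ (seg0 s) ∈ idealBdry T.C := by
    intro s h0 h1
    refine ⟨mk_mem_closure (seg s h0 h1) _, fun hcon => ?_⟩
    refine hn (1 - s) s (by linarith) h0.le (by linarith) ⟨?_, seg0 s, T.C_sub hcon⟩
    rw [fseg]; simp
  have segO : ∀ s : ℝ, 0 < s → s < 1 → (1 - s) • x + s • z ∈ openSegment ℝ x z :=
    fun s h0 h1 => ⟨1 - s, s, by linarith, h0, by ring, rfl⟩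
  set w := (1 - (1 / 2 : ℝ)) • x + (1 / 2 : ℝ) • z with hw
  have hwK : w ∈ closure K := closure_mono hCK (seg (1 / 2) (by norm_num) (by norm_num))
  have fw : f w = 1 := fseg _
  have hw0 : w ≠ 0 := seg0 _
  have hWB : Projectivization.mk ℝ w hw0 ∈ idealBdry T.C :=
    segB (1 / 2) (by norm_num) (by norm_num)
  have hKF := hK.KF_cone fw
  have hmem := face_mem hΩ ho hw0 hwK fw
  have hpc := face_pc hΩ ho hw0 hwK fw
  have segF : ∀ s : ℝ, 0 < s → s < 1 → (1 - s) • x + s • z ∈ KF K w := fun s h0 h1 =>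
    hK.KF_of_seg hxK hzK (segO (1 / 2) (by norm_num) (by norm_num)) (segO s h0 h1)
  have hcd := h _ hWB
  set F := face T.Ω (Projectivization.mk ℝ w hw0) with hF
  have hWF : Projectivization.mk ℝ w hw0 ∈ F := Or.inl rfl
  -- extract a ball
  obtain ⟨R, hR, q, hqF, hq⟩ : ∃ R : ℝ, 0 < R ∧ ∃ q ∈ F, ∀ p ∈ idealBdry T.C ∩ F,
      hilbertDist F p q < R := by
    have hne : {k : ℕ | ∃ R : ℝ, 0 < R ∧ ∃ B : Set (PSpace d), B ⊆ F ∧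
        Convex ℝ (cmap F '' B) ∧ pdimIn F B = k ∧
        idealBdry T.C ∩ F ⊆ {p ∈ F | ∃ q ∈ B, hilbertDist F p q < R}}.Nonempty := by
      refine ⟨pdimIn F F, 1, one_pos, F, Subset.rfl, (chart_spec hpc).2.1, rfl, ?_⟩
      rintro p ⟨_, hp⟩
      exact ⟨hp, p, hp, by simp [hilbertDist, hilbertDistChart]⟩
    have h0 := Nat.sInf_mem hne
    rw [cdim] at hcd
    rw [hcd] at h0
    obtain ⟨R, hR, B, hBF, -, hdim, hB⟩ := h0
    obtain ⟨-, q, hqB, -⟩ := hB ⟨hWB, hWF⟩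
    refine ⟨R, hR, q, hBF hqB, fun p hp => ?_⟩
    obtain ⟨-, q', hq'B, hlt⟩ := hB hp
    have : cmap F q' = cmap F q := by
      rw [pdimIn, Submodule.finrank_eq_zero, direction_affineSpan] at hdim
      have h1 : cmap F q' -ᵥ cmap F q ∈ vectorSpan ℝ (cmap F '' B) :=
        vsub_mem_vectorSpan ℝ ⟨q', hq'B, rfl⟩ ⟨q, hqB, rfl⟩
      rw [hdim, Submodule.mem_bot] at h1
      exact vsub_eq_zero_iff_eq.1 h1
    rw [hilbertDist, this] at hlt
    exact hlt
  obtain ⟨b, hbKF, hb0, hbq⟩ : ∃ b ∈ KF K w, ∃ hb0 : b ≠ 0, Projectivization.mk ℝ b hb0 = q := by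
    have h1 := hqF
    rw [← Projectivization.mk_rep q, hmem] at h1
    rcases h1 with h1 | h1
    · exact ⟨_, h1, Projectivization.rep_nonzero q, Projectivization.mk_rep q⟩
    · exact ⟨_, h1, neg_ne_zero.2 (Projectivization.rep_nonzero q), by
        rw [mk_neg_eq _ (Projectivization.rep_nonzero q), Projectivization.mk_rep]⟩
  have fb := hKF.pos b hbKF
  have est : ∀ s : ℝ, 0 < s → s < 1 →
      (Real.exp (2 * R) * f b) • ((1 - s) • x + s • z) - b ∈ closure K := by
    intro s h0 h1
    have hp := segF s h0 h1
    have hd := hq _ ⟨segB s h0 h1, (hmem _ (seg0 s)).2 (Or.inl hp)⟩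
    rw [← hbq, hilbert_eq hpc hKF hmem hp hbKF] at hd
    have g1 := hKF.MM_ge hp hbKF
    rw [fseg] at g1
    have g2 := Real.log_le_log (by positivity) g1
    rw [one_div, Real.log_inv] at g2
    rw [DD] at hd
    have g3 : Real.log (MM (KF K w) b ((1 - s) • x + s • z)) < 2 * R + Real.log (f b) := by
      linarith
    have g4 := (Real.log_lt_iff_lt_exp (hKF.MM_pos hbKF hp)).1 g3
    rw [Real.exp_add, Real.exp_log fb] at g4
    exact ((hKF.mem_iff hbKF hp).2 g4).1
  have lim : (Real.exp (2 * R) * f b) • x - b ∈ closure K := by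
    have hcont : Continuous fun s : ℝ =>
        (Real.exp (2 * R) * f b) • ((1 - s) • x + s • z) - b := by fun_prop
    have ht : Tendsto (fun s : ℝ => (Real.exp (2 * R) * f b) • ((1 - s) • x + s • z) - b)
        (nhdsWithin 0 (Ioi 0)) (nhds ((Real.exp (2 * R) * f b) • x - b)) := by
      have := (hcont.tendsto 0).mono_left (nhdsWithin_le_nhds (s := Ioi 0))
      simpa using this
    refine isClosed_closure.mem_of_tendsto ht ?_
    have : Ioo (0 : ℝ) 1 ∈ nhdsWithin (0 : ℝ) (Ioi 0) := Ioo_mem_nhdsGT one_pos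
    filter_upwards [this] with s hs using est s hs.1 hs.2
  obtain ⟨-, ⟨L, hL, h2⟩, -⟩ := hbKF
  refine ⟨2 * (L * (Real.exp (2 * R) * f b)) - 1, ?_⟩
  have := hK.closure_smul (hK.closure_add (hK.closure_smul lim hL) h2) (show (0 : ℝ) < 2 by norm_num)
  convert this using 1
  rw [hw]; module

theorem pact_mk (g : (Fin d → ℝ) ≃ₗ[ℝ] (Fin d → ℝ)) (v : Fin d → ℝ) (hv : v ≠ 0) (h : g v ≠ 0) :
    pact g (Projectivization.mk ℝ v hv) = Projectivization.mk ℝ (g v) h := rfl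

theorem pact_mem {Λ : Subgroup ((Fin d → ℝ) ≃ₗ[ℝ] (Fin d → ℝ))} {A : Set (PSpace d)}
    (hA : ∀ g ∈ Λ, pact g '' A = A) {g} (hg : g ∈ Λ) (v : Fin d → ℝ) (hv : v ≠ 0)
    (h : g v ≠ 0) :
    Projectivization.mk ℝ (g v) h ∈ A ↔ Projectivization.mk ℝ v hv ∈ A := by
  have fwd : ∀ g ∈ Λ, ∀ (v : Fin d → ℝ) (hv : v ≠ 0) (h : g v ≠ 0),
      Projectivization.mk ℝ v hv ∈ A → Projectivization.mk ℝ (g v) h ∈ A := by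
    intro g hg v hv h hm
    rw [← hA g hg]
    exact ⟨_, hm, rfl⟩
  constructor
  · intro hm
    have e : g⁻¹ (g v) = v := g.symm_apply_apply v
    have := fwd g⁻¹ (Λ.inv_mem hg) (g v) h (by rwa [e]) hm
    simpa only [e] using this
  · exact fwd g hg v hv h

theorem NCC_G (T : NCCTriple d) {K₀ : Set (PSpace d)} (hK₀ : K₀ ⊆ T.C)
    (hcov : T.C ⊆ ⋃ g ∈ T.Λ, pact g '' K₀) (u : Fin d → ℝ) (hu : u ∈ Kc (chartOf T.Ω) T.C) :
    ∃ g : (Fin d → ℝ) →ₗ[ℝ] (Fin d → ℝ),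
      (∀ v, g v ∈ Kc (chartOf T.Ω) T.Ω ↔ v ∈ Kc (chartOf T.Ω) T.Ω) ∧
      (∀ v ∈ Kc (chartOf T.Ω) T.C, g v ∈ Kc (chartOf T.Ω) T.C) ∧
      g u ∈ chartMap (chartOf T.Ω) '' K₀ := by
  have hΩ := T.properlyConvex_Ω
  have hK := Omega_cone hΩ T.isOpen_Ω
  obtain ⟨hf, hc, hb⟩ := chart_spec hΩ
  have hmem := Omega_mem (Ω := T.Ω) (f := chartOf T.Ω) (fun x hx => hf x (subset_closure hx))
  set f := chartOf T.Ω with hfdef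
  set K := Kc f T.Ω with hKdef
  have hCK : Kc f T.C ⊆ K := fun v hv => ⟨hv.1, hv.2.1, T.C_sub hv.2.2⟩
  obtain ⟨pu, hu0, huC⟩ := hu
  have huK : u ∈ K := ⟨pu, hu0, T.C_sub huC⟩
  obtain ⟨g, hg, k, hk, hgk⟩ : ∃ g ∈ T.Λ, ∃ k ∈ K₀, pact g k = Projectivization.mk ℝ u hu0 := by
    have := hcov huC
    simp only [mem_iUnion, exists_prop] at this
    obtain ⟨g, hg, k, hk, h⟩ := this
    exact ⟨g, hg, k, hk, h⟩
  have hgi : g⁻¹ ∈ T.Λ := T.Λ.inv_mem hg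
  have inj0 : ∀ v, v ≠ 0 → g⁻¹ v ≠ 0 := fun v hv => by
    rw [ne_eq, LinearEquiv.map_eq_zero_iff]; exact hv
  have hk' : Projectivization.mk ℝ (g⁻¹ u) (inj0 u hu0) = k := by
    rw [← pact_mk g⁻¹ u hu0, ← hgk, ← Projectivization.mk_rep k,
      pact_mk g _ (Projectivization.rep_nonzero k)
        (by rw [ne_eq, LinearEquiv.map_eq_zero_iff]; exact Projectivization.rep_nonzero k),
      pact_mk g⁻¹ _ _ (inj0 _ (by
        rw [ne_eq, LinearEquiv.map_eq_zero_iff]; exact Projectivization.rep_nonzero k))]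
    congr 1
    exact g.symm_apply_apply _
  set c := f (g⁻¹ u) with hcdef
  have hc0 : c ≠ 0 := by
    rw [hcdef, ← f_mk_ne f _ (inj0 u hu0), hk']
    exact hf _ (subset_closure (T.C_sub (hK₀ hk)))
  set G : (Fin d → ℝ) →ₗ[ℝ] (Fin d → ℝ) := c⁻¹ • (g⁻¹).toLinearMap with hG
  have Gv : ∀ v, G v = c⁻¹ • g⁻¹ v := fun v => rfl
  have Gn : ∀ v, v ≠ 0 → G v ≠ 0 := fun v hv => by
    rw [Gv]; exact smul_ne_zero (inv_ne_zero hc0) (inj0 v hv)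
  have Gmk : ∀ v (hv : v ≠ 0), Projectivization.mk ℝ (G v) (Gn v hv) =
      Projectivization.mk ℝ (g⁻¹ v) (inj0 v hv) := fun v hv =>
    mk_smul_eq _ (inj0 v hv) _ _
  have GΩ : ∀ v (hv : v ≠ 0), (G v ∈ K ∨ -(G v) ∈ K) ↔ (v ∈ K ∨ -v ∈ K) := by
    intro v hv
    rw [← hmem _ (Gn v hv), ← hmem v hv, Gmk v hv, pact_mem T.inv_Ω hgi]
  have Gu : G u = chartMap f k := by
    rw [← hk', chartMap_mk]; exact Gv u
  have fGu : 0 < f (G u) := by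
    rw [Gu, (chartMap_mem_Kc hk (hf _ (subset_closure (T.C_sub (hK₀ hk))))).2.1]; exact one_pos
  have K0 : ∀ v ∈ K, v ≠ 0 := fun v hv => hv.2.1
  have fwd : ∀ v ∈ K, G v ∈ K := by
    intro v hv
    rcases (GΩ v (K0 v hv)).2 (Or.inl hv) with h | h
    · exact h
    exfalso
    have h1 : f (G v) < 0 := by simpa using hK.pos _ h
    have h2 := hK.add _ (hK.smul _ fGu v hv) _ (hK.smul (-f (G v)) (by linarith) u huK)
    have h3 := (GΩ _ (K0 _ h2)).2 (Or.inl h2)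
    have h4 : f (G (f (G u) • v + -f (G v) • u)) = 0 := by
      simp only [map_add, map_smul, smul_eq_mul]; ring
    rcases h3 with h3 | h3
    · have := hK.pos _ h3
      linarith
    · have := hK.pos _ h3
      rw [map_neg] at this
      linarith
  refine ⟨G, fun v => ⟨fun hv => ?_, fwd v⟩, fun v hv => ?_, ?_⟩
  · have hv0 : v ≠ 0 := by
      rintro rfl
      exact K0 _ hv (map_zero G)
    rcases (GΩ v hv0).1 (Or.inl hv) with h | h
    · exact h
    · have h1 := hK.pos _ (fwd _ h)
      have h2 := hK.pos _ hv
      rw [map_neg, map_neg] at h1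
      linarith
  · have h1 := fwd v (hCK hv)
    obtain ⟨-, hv0, hvC⟩ := hv
    refine ⟨h1.1, Gn v hv0, ?_⟩
    rw [Gmk v hv0, pact_mem T.inv_C hgi v hv0]
    exact hvC
  · rw [Gu]; exact ⟨k, hk, rfl⟩

end Main


/-- Lemma 5.4: if every face of the ideal boundary of a naive convex
co-compact triple has coarse dimension zero, then `(C, d_Ω)` is Gromov hyperbolic. -/
theorem cdim_zero_implies_gromov_hyperbolic {d : ℕ} (T : NCCTriple d)
    (h : ∀ x ∈ idealBdry T.C, cdim (face T.Ω x) (idealBdry T.C ∩ face T.Ω x) = 0) :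
    GromovHyperbolicOn T.Ω T.C := by
  have hΩ := T.properlyConvex_Ω
  have ho := T.isOpen_Ω
  obtain ⟨hf, hc, hb⟩ := chart_spec hΩ
  have hK := Omega_cone hΩ ho
  have hmem := Omega_mem (Ω := T.Ω) (f := chartOf T.Ω) (fun x hx => hf x (subset_closure hx))
  have hfC : ∀ x ∈ T.C, chartOf T.Ω x.rep ≠ 0 := fun x hx => hf x (subset_closure (T.C_sub hx))
  have hCK : Kc (chartOf T.Ω) T.C ⊆ Kc (chartOf T.Ω) T.Ω :=
    fun v hv => ⟨hv.1, hv.2.1, T.C_sub hv.2.2⟩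
  obtain ⟨K₀, hK₀, hK₀c, hcov⟩ := T.cocompact
  have hbd : Bornology.IsBounded {v ∈ Kc (chartOf T.Ω) T.Ω | chartOf T.Ω v = 1} := by
    refine hb.subset ?_
    rintro v ⟨h1, h2⟩
    exact (Kc_base (fun x hx => hf x (subset_closure hx)) h2).1 h1
  have hQ : IsCompact (chartMap (chartOf T.Ω) '' K₀) :=
    hK₀c.image_of_continuousOn ((chartMap_contOn _).mono fun x hx => hfC x (hK₀ hx))
  have hQK : chartMap (chartOf T.Ω) '' K₀ ⊆ Kc (chartOf T.Ω) T.Ω := by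
    rintro _ ⟨x, hx, rfl⟩
    exact hCK (chartMap_mem_Kc (hK₀ hx) (hfC x (hK₀ hx))).1
  obtain ⟨δ, hδ⟩ := hK.thin (Kc_open ho) hbd hCK (Kc_smul _ _) hQ hQK
    (NCC_G T hK₀ hcov) (Kc_add hfC T.C_convex) (NCC_H T h)
  obtain ⟨δ', h0, hδ'⟩ := hK.fourpoint (Kc_open ho) hCK hδ
  have hd : ∀ x ∈ T.C, ∀ y ∈ T.C, hilbertDist T.Ω x y =
      DD (Kc (chartOf T.Ω) T.Ω) (chartMap (chartOf T.Ω) x) (chartMap (chartOf T.Ω) y) := by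
    intro x hx y hy
    obtain ⟨a1, -, a2, a3⟩ := chartMap_mem_Kc hx (hfC x hx)
    obtain ⟨b1, -, b2, b3⟩ := chartMap_mem_Kc hy (hfC y hy)
    rw [← hilbert_eq hΩ hK hmem (hCK a1) (hCK b1) a2 b2, a3, b3]
  refine ⟨δ', h0, fun x hx y hy z hz w hw => ?_⟩
  have := hδ' _ (chartMap_mem_Kc hx (hfC x hx)).1 _ (chartMap_mem_Kc hy (hfC y hy)).1
    _ (chartMap_mem_Kc hz (hfC z hz)).1 _ (chartMap_mem_Kc hw (hfC w hw)).1
  simp only [gromovProd]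
  rw [hd x hx w hw, hd y hy w hw, hd z hz w hw, hd x hx y hy, hd y hy z hz, hd x hx z hz]
  exact this

end Paper
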